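/- arXiv:1211.2672 — 2 statements merged into one kernel-verified Lean document; each statement's English description precedes it below -/
import Mathlib

section
/- Let q ≥ 4 be a power of two. Then there exists a (q+1)-regular graph of girth 7 with exactly 2q^3 + q^2 + 2q vertices. -/
namespace GirthSeven

/-- Vertices of the graph: the points `pt x y z` of the affine space `AG(3, F)`, its lines
`ln i c t` of direction `(1, i, i²)` and `vl x y` of direction `(0, 0, 1)`, and the planes
`hp c : z = c` and `vp c : x = c`. -/
inductive Vert (F : Type)
  | pt (x y z : F)
  | ln (i c t : F)
  | vl (x y : F)
  | hp (c : F)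
  | vp (c : F)

namespace Vert

variable {F : Type}

/-- The vertices, as a disjoint sum of products of copies of `F`. -/
def equivSum : Vert F ≃ (F × F × F) ⊕ (F × F × F) ⊕ (F × F) ⊕ F ⊕ F where
  toFun
    | pt x y z => .inl (x, y, z)
    | ln i c t => .inr (.inl (i, c, t))
    | vl x y => .inr (.inr (.inl (x, y)))
    | hp c => .inr (.inr (.inr (.inl c)))
    | vp c => .inr (.inr (.inr (.inr c)))
  invFun
    | .inl (x, y, z) => pt x y z
    | .inr (.inl (i, c, t)) => ln i c t
    | .inr (.inr (.inl (x, y))) => vl x y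
    | .inr (.inr (.inr (.inl c))) => hp c
    | .inr (.inr (.inr (.inr c))) => vp c
  left_inv v := by cases v <;> rfl
  right_inv v := by rcases v with _ | _ | _ | _ | _ <;> rfl

instance [Finite F] : Finite (Vert F) := Finite.of_equiv _ equivSum.symm

lemma natCard [Finite F] :
    Nat.card (Vert F) = 2 * Nat.card F ^ 3 + Nat.card F ^ 2 + 2 * Nat.card F := by
  rw [Nat.card_congr equivSum]
  simp only [Nat.card_sum, Nat.card_prod]
  ring

variable [Field F]

/-- Adjacency: incidence of points and lines, containment of lines of the two special directions
in planes, a matching on the lines of each other direction within each plane spanned by that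
direction and the nucleus `(0, 1, 0)`, and a matching on each class of special planes. -/
def Rel : Vert F → Vert F → Prop
  | pt x y z, ln i c t => y = i * x + t ∧ z = i ^ 2 * x + c
  | ln i c t, pt x y z => y = i * x + t ∧ z = i ^ 2 * x + c
  | pt x y _, vl x' y' => x = x' ∧ y = y'
  | vl x' y', pt x y _ => x = x' ∧ y = y'
  | ln i c t, ln i' c' t' => i ≠ 0 ∧ i' = i ∧ c' = c ∧ t' = t + i
  | ln i c _, hp d => i = 0 ∧ c = d
  | hp d, ln i c _ => i = 0 ∧ c = d
  | vl x _, vp d => x = d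
  | vp d, vl x _ => x = d
  | hp c, hp d => d = c + 1
  | vp c, vp d => d = c + 1
  | _, _ => False

/-- The neighbours of a vertex, enumerated by `Option F`. -/
noncomputable def nbr : Vert F → Option F → Vert F
  | pt x y _, none => vl x y
  | pt x y z, some i => ln i (z - i ^ 2 * x) (y - i * x)
  | ln i c t, none => open Classical in if i = 0 then hp c else ln i c (t + i)
  | ln i c t, some x => pt x (i * x + t) (i ^ 2 * x + c)
  | vl x _, none => vp x
  | vl x y, some z => pt x y z
  | hp c, none => hp (c + 1)
  | hp c, some t => ln 0 c t
  | vp c, none => vp (c + 1)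
  | vp c, some y => vl c y

lemma nbr_injective (v : Vert F) : Function.Injective (nbr v) := by
  rintro (_ | a) (_ | b) h <;> cases v <;> grind [nbr]

/-- A closed non-backtracking sequence of vertices of period `n`. -/
structure IsClosedSeq (n : ℕ) (f : ℕ → Vert F) : Prop where
  rel (k : ℕ) : Rel (f k) (f (k + 1))
  ne (k : ℕ) : f k ≠ f (k + 2)
  per (k : ℕ) : f (k + n) = f k

lemma IsClosedSeq.shift {n : ℕ} {f : ℕ → Vert F} (h : IsClosedSeq n f) (m : ℕ) :
    IsClosedSeq n (fun k => f (k + m)) where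
  rel k := by simpa [add_right_comm] using h.rel (k + m)
  ne k := by simpa [add_right_comm] using h.ne (k + m)
  per k := by simpa [add_right_comm] using h.per (k + m)

lemma IsClosedSeq.not_pt_pt {n : ℕ} {f : ℕ → Vert F} (h : IsClosedSeq n f) {k : ℕ}
    {a b c a' b' c' : F} (h1 : f k = pt a b c) (h2 : f (k + 1) = pt a' b' c') : False := by
  simpa [h1, h2, Rel] using h.rel k

lemma pt_of_vl {u v w : Vert F} {x y : F} (hu : Rel u v) (hw : Rel v w) (h : u ≠ w)
    (hv : v = vl x y) : (∃ x y z, u = pt x y z) ∨ ∃ x y z, w = pt x y z := by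
  subst hv
  cases u <;> cases w <;> simp only [Rel] at hu hw <;> grind

/-- Two distinct points determine the line of `AG(3, F)` joining them. -/
lemma line_unique {i j c d t s x y z x' y' : F} (hx : x ≠ x')
    (h1 : y = i * x + t) (h2 : z = i ^ 2 * x + c) (h3 : y' = i * x' + t)
    (h4 : y = j * x + s) (h5 : z = j ^ 2 * x + d) (h6 : y' = j * x' + s) : ln i c t = ln j d s := by
  have h : (i - j) * (x - x') = 0 := by linear_combination h4 - h6 - h1 + h3
  have hij : i = j := by
    rcases mul_eq_zero.1 h with h | h
    · exact sub_eq_zero.1 h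
    · exact absurd (sub_eq_zero.1 h) hx
  subst hij
  grind

/-- Three lines with directions on the conic do not form a triangle. -/
lemma no_triangle {i j k a b : F} (ha : a ≠ 0) (hb : b ≠ 0) (hab : a + b ≠ 0)
    (h1 : i * a + j * b = k * (a + b)) (h2 : i ^ 2 * a + j ^ 2 * b = k ^ 2 * (a + b)) :
    i = j := by
  have h3 : (i - k) * a = (k - j) * b := by linear_combination h1
  have h4 : (i - k) * a * (i - j) = 0 := by linear_combination h2 - (k + j) * h1
  have h5 : (k - j) * b * (i - j) = 0 := h3 ▸ h4
  grind

variable [CharP F 2]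

lemma eq_add_iff {a b c : F} : a = b + c ↔ b = a + c := by
  have h := CharTwo.add_self_eq_zero c
  grind

variable (F) in
/-- The graph on `Vert F` with adjacency `Vert.Rel`. -/
def graph : SimpleGraph (Vert F) where
  Adj := Rel
  symm := ⟨by
    rintro (_ | _ | _ | _ | _) (_ | _ | _ | _ | _) h <;> simp only [Rel] at h ⊢ <;>
      grind [eq_add_iff]⟩
  loopless := ⟨by
    rintro (_ | _ | _ | _ | _) h <;> simp [Rel] at h⟩

@[simp] lemma graph_adj {u v : Vert F} : (graph F).Adj u v ↔ Rel u v := Iff.rfl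

lemma rel_iff (u v : Vert F) : Rel u v ↔ ∃ o, nbr u o = v := by
  rw [Option.exists]
  cases u <;> cases v <;> simp [Rel, nbr] <;> grind

lemma ncard_neighborSet [Finite F] (v : Vert F) :
    ((graph F).neighborSet v).ncard = Nat.card F + 1 := by
  have : (graph F).neighborSet v = Set.range (nbr v) := by
    ext w
    simp [rel_iff]
  rw [this, ← Set.image_univ, Set.ncard_image_of_injective _ (nbr_injective v), Set.ncard_univ,
    Finite.card_option]

lemma pt_of_ln {u v w : Vert F} {i c t : F} (hu : Rel u v) (hw : Rel v w) (h : u ≠ w)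
    (hv : v = ln i c t) : (∃ x y z, u = pt x y z) ∨ ∃ x y z, w = pt x y z := by
  subst hv
  cases u <;> cases w <;> simp only [Rel] at hu hw <;> grind [eq_add_iff]

lemma line_of_hp {u v w : Vert F} {d : F} (hu : Rel u v) (hw : Rel v w) (h : u ≠ w)
    (hv : v = hp d) : (∃ i c t, u = ln i c t) ∨ ∃ i c t, w = ln i c t := by
  subst hv
  cases u <;> cases w <;> simp only [Rel] at hu hw <;> grind [eq_add_iff]

lemma line_of_vp {u v w : Vert F} {d : F} (hu : Rel u v) (hw : Rel v w) (h : u ≠ w)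
    (hv : v = vp d) : (∃ x y, u = vl x y) ∨ ∃ x y, w = vl x y := by
  subst hv
  cases u <;> cases w <;> simp only [Rel] at hu hw <;> grind [eq_add_iff]

lemma IsClosedSeq.exists_pt {n : ℕ} {f : ℕ → Vert F} (h : IsClosedSeq n f) :
    ∃ k x y z, f k = pt x y z := by
  have hl {k i c t} (hk : f (k + 1) = ln i c t) : ∃ k x y z, f k = pt x y z :=
    (pt_of_ln (h.rel k) (h.rel (k + 1)) (h.ne k) hk).elim (⟨_, ·⟩) (⟨_, ·⟩)
  have hv {k x y} (hk : f (k + 1) = vl x y) : ∃ k x y z, f k = pt x y z :=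
    (pt_of_vl (h.rel k) (h.rel (k + 1)) (h.ne k) hk).elim (⟨_, ·⟩) (⟨_, ·⟩)
  rcases h2 : f 2 with _ | _ | _ | _ | _
  · exact ⟨_, _, _, _, h2⟩
  · exact hl h2
  · exact hv h2
  · rcases line_of_hp (h.rel 1) (h.rel 2) (h.ne 1) h2 with ⟨_, _, _, h'⟩ | ⟨_, _, _, h'⟩ <;>
      exact hl h'
  · rcases line_of_vp (h.rel 1) (h.rel 2) (h.ne 1) h2 with ⟨_, _, h'⟩ | ⟨_, _, h'⟩ <;>
      exact hv h'

/-- The ways a non-backtracking sequence starting at a point can reach the next point. -/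
lemma IsClosedSeq.segment {n : ℕ} {f : ℕ → Vert F} (h : IsClosedSeq n f) {k : ℕ} {x y z : F}
    (hk : f k = pt x y z) :
    (∃ i c t x' y' z', f (k + 1) = ln i c t ∧ f (k + 2) = pt x' y' z' ∧
      y = i * x + t ∧ z = i ^ 2 * x + c ∧ y' = i * x' + t ∧ z' = i ^ 2 * x' + c ∧ x ≠ x') ∨
    (∃ z', f (k + 1) = vl x y ∧ f (k + 2) = pt x y z' ∧ z ≠ z') ∨
    (∃ i c t x' y' z', f (k + 1) = ln i c t ∧ f (k + 2) = ln i c (t + i) ∧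
      f (k + 3) = pt x' y' z' ∧ i ≠ 0 ∧
      y = i * x + t ∧ z = i ^ 2 * x + c ∧ y' = i * x' + (t + i) ∧ z' = i ^ 2 * x' + c) ∨
    (∃ x' y', f (k + 1) = ln 0 z y ∧ f (k + 2) = hp z ∧ f (k + 3) = ln 0 z y' ∧
      f (k + 4) = pt x' y' z ∧ y ≠ y') ∨
    (∃ y' z', f (k + 1) = vl x y ∧ f (k + 2) = vp x ∧ f (k + 3) = vl x y' ∧
      f (k + 4) = pt x y' z' ∧ y ≠ y') ∨
    (∃ x' y', f (k + 1) = ln 0 z y ∧ f (k + 2) = hp z ∧ f (k + 3) = hp (z + 1) ∧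
      f (k + 4) = ln 0 (z + 1) y' ∧ f (k + 5) = pt x' y' (z + 1)) ∨
    (∃ y' z', f (k + 1) = vl x y ∧ f (k + 2) = vp x ∧ f (k + 3) = vp (x + 1) ∧
      f (k + 4) = vl (x + 1) y' ∧ f (k + 5) = pt (x + 1) y' z') := by
  have r0 := h.rel k
  have r1 := h.rel (k + 1)
  have r2 := h.rel (k + 2)
  have r3 := h.rel (k + 3)
  have r4 := h.rel (k + 4)
  have n0 := h.ne k
  have n1 := h.ne (k + 1)
  have n2 := h.ne (k + 2)
  have n3 := h.ne (k + 3)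
  simp only [add_assoc, Nat.reduceAdd] at r0 r1 r2 r3 r4 n0 n1 n2 n3
  rw [hk] at r0 n0
  rcases e1 : f (k + 1) with _ | ⟨i, c, t⟩ | ⟨a, b⟩ | _ | _ <;> simp only [e1, Rel] at r0 r1 n1
  · rcases e2 : f (k + 2) with ⟨x', y', z'⟩ | ⟨i', c', t'⟩ | _ | d | _ <;>
      simp only [e2, Rel] at r1 r2 n0 n2
    · left
      exact ⟨i, c, t, x', y', z', rfl, rfl, r0.1, r0.2, r1.1, r1.2, by grind⟩
    · obtain ⟨hi, rfl, rfl, rfl⟩ := r1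
      rcases e3 : f (k + 3) with ⟨x', y', z'⟩ | _ | _ | _ | _ <;>
        simp only [e3] at r2 n1
      · right; right; left
        exact ⟨_, _, _, x', y', z', rfl, rfl, rfl, hi, r0.1, r0.2, r2.1, r2.2⟩
      · grind [eq_add_iff]
      · grind
    · obtain ⟨rfl, rfl⟩ := r1
      obtain ⟨rfl, rfl⟩ : y = t ∧ z = c := by simpa using r0
      rcases e3 : f (k + 3) with _ | ⟨i', c', t'⟩ | _ | d | _ <;>
        simp only [e3, Rel] at r2 r3 n1 n3
      · obtain ⟨rfl, rfl⟩ := r2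
        rcases e4 : f (k + 4) with ⟨x', y', z'⟩ | _ | _ | _ | _ <;>
          simp only [e4] at r3 n2
        · right; right; right; left
          obtain ⟨rfl, rfl⟩ : y' = t' ∧ z' = c' := by simpa using r3
          exact ⟨x', y', rfl, rfl, rfl, rfl, by grind⟩
        · grind
        · grind
      · subst r2
        rcases e4 : f (k + 4) with _ | ⟨i', c', t'⟩ | _ | _ | _ <;>
          simp only [e4, Rel] at r3 r4 n2
        · obtain ⟨rfl, rfl⟩ := r3
          rcases e5 : f (k + 5) with ⟨x', y', z'⟩ | _ | _ | _ | _ <;>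
            simp only [e5] at r4 n3
          · right; right; right; right; right; left
            obtain ⟨rfl, rfl⟩ : y' = t' ∧ z' = z + 1 := by simpa using r4
            exact ⟨x', y', rfl, rfl, rfl, rfl, rfl⟩
          · grind
          · grind
        · grind [eq_add_iff]
  · obtain ⟨rfl, rfl⟩ := r0
    rcases e2 : f (k + 2) with ⟨x', y', z'⟩ | _ | _ | _ | d <;>
      simp only [e2, Rel] at r1 r2 n0 n2
    · right; left
      obtain ⟨rfl, rfl⟩ := r1
      exact ⟨z', rfl, rfl, by grind⟩
    · subst r1
      rcases e3 : f (k + 3) with _ | _ | ⟨a, b⟩ | _ | d <;>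
        simp only [e3, Rel] at r2 r3 n1 n3
      · subst r2
        rcases e4 : f (k + 4) with ⟨x', y', z'⟩ | _ | _ | _ | _ <;>
          simp only [e4] at r3 n2
        · right; right; right; right; left
          obtain ⟨rfl, rfl⟩ := r3
          exact ⟨y', z', rfl, rfl, rfl, rfl, by grind⟩
        · grind
      · subst r2
        rcases e4 : f (k + 4) with _ | _ | ⟨a, b⟩ | _ | _ <;>
          simp only [e4, Rel] at r3 r4 n2
        · subst r3
          rcases e5 : f (k + 5) with ⟨x', y', z'⟩ | _ | _ | _ | _ <;>
            simp only [e5] at r4 n3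
          · right; right; right; right; right; right
            obtain ⟨rfl, rfl⟩ := r4
            exact ⟨y', z', rfl, rfl, rfl, rfl, rfl⟩
          · grind
        · grind [eq_add_iff]

/-- In a short closed sequence, no two points are at distance two. -/
lemma IsClosedSeq.not_pt_pt_of_le_six {n : ℕ} {f : ℕ → Vert F} (h : IsClosedSeq n f)
    (hn : 3 ≤ n) (hn' : n ≤ 6) {x y z x' y' z' : F} (h0 : f 0 = pt x y z)
    (h2 : f 2 = pt x' y' z') : False := by
  have p0 := h.per 0
  rw [h0] at p0
  have n1 := h.ne 1
  have hn3 : n ≠ 3 := by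
    rintro rfl
    exact h.not_pt_pt h2 p0
  have e1 : (∃ i c t, f 1 = ln i c t ∧ y = i * x + t ∧ z = i ^ 2 * x + c ∧
      y' = i * x' + t ∧ z' = i ^ 2 * x' + c ∧ x ≠ x') ∨
      (f 1 = vl x y ∧ x' = x ∧ y' = y ∧ z ≠ z') := by
    have := h.segment h0
    simp only [zero_add, h2] at this
    grind
  rcases h.segment h2 with ⟨j, d, s, x'', y'', z'', e3, e4, r⟩ | ⟨z'', e3, e4, r⟩ |
    ⟨j, d, s, x'', y'', z'', e3, e4, e5, hj, r⟩ | ⟨x'', y'', e3, e4, e5, e6, r⟩ |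
    ⟨y'', z'', e3, e4, e5, e6, r⟩ | ⟨_, _, e3, e4, e5, e6, e7⟩ | ⟨_, _, e3, e4, e5, e6, e7⟩ <;>
    simp only [Nat.reduceAdd] at e3 e4 <;> simp only [Nat.reduceAdd, e3] at n1
  · have e5 (h6 : f 6 = pt x y z) : (∃ k c t, f 5 = ln k c t ∧ y'' = k * x'' + t ∧
        z'' = k ^ 2 * x'' + c ∧ y = k * x + t ∧ z = k ^ 2 * x + c ∧ x'' ≠ x) ∨
        (f 5 = vl x y ∧ x'' = x ∧ y'' = y ∧ z'' ≠ z) := by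
      have := h.segment e4
      simp only [Nat.reduceAdd, h6] at this
      grind
    interval_cases n
    · contradiction
    · obtain ⟨rfl, rfl, rfl⟩ : x'' = x ∧ y'' = y ∧ z'' = z := by simpa [e4] using p0
      obtain ⟨r1, r2, r3, r4, r5⟩ := r
      rcases e1 with ⟨i, c, t, e1, q1, q2, q3, q4, q5⟩ | e1
      · exact n1 (e1.trans (line_unique q5 q1 q2 q3 r3 r4 r1))
      · grind
    · exact h.not_pt_pt e4 p0
    · obtain ⟨r1, r2, r3, r4, r5⟩ := r
      rcases e1 with ⟨i, c, t, e1, q1, q2, q3, q4, q5⟩ | ⟨e1, q⟩ <;>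
        rcases e5 p0 with ⟨k, b, l, e5, u1, u2, u3, u4, u5⟩ | ⟨e5, u⟩
      · have : i = j := no_triangle (k := k) (a := x' - x) (b := x'' - x') (by grind) (by grind)
          (by grind) (by grind) (by grind)
        grind
      · have : (i - j) * (x - x') = 0 := by grind
        grind
      · have : (j - k) * (x - x'') = 0 := by grind
        grind
      · grind
  · have e5 (h6 : f 6 = pt x y z) : (∃ k c t, f 5 = ln k c t ∧ y' = k * x' + t ∧
        z'' = k ^ 2 * x' + c ∧ y = k * x + t ∧ z = k ^ 2 * x + c ∧ x' ≠ x) ∨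
        (f 5 = vl x' y') := by
      have := h.segment e4
      simp only [Nat.reduceAdd, h6] at this
      grind
    interval_cases n
    · contradiction
    · grind
    · exact h.not_pt_pt e4 p0
    · rcases e1 with ⟨i, c, t, e1, q1, q2, q3, q4, q5⟩ | ⟨e1, q⟩ <;>
        rcases e5 p0 with ⟨k, b, l, e5, u1, u2, u3, u4, u5⟩ | e5
      · have : (i - k) * (x - x') = 0 := by grind
        grind
      · have := h.ne 3
        grind
      · grind
      · grind
  · interval_cases n
    · contradiction
    · grind
    · obtain ⟨rfl, rfl, rfl⟩ : x'' = x ∧ y'' = y ∧ z'' = z := by simpa [e5] using p0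
      rcases e1 with ⟨i, c, t, e1, q1, q2, q3, q4, q5⟩ | ⟨e1, q⟩
      · have : (i - j) * (i + j) * (x'' - x') = 0 := by grind
        have : (i - j) * (i - j) * (x'' - x') = 0 := by grind
        grind
      · grind
    · exact h.not_pt_pt e5 p0
  · interval_cases n
    · contradiction
    · grind
    · grind
    · grind
  · interval_cases n
    · contradiction
    · grind
    · grind
    · grind
  · interval_cases n <;> grind
  · interval_cases n <;> grind

lemma IsClosedSeq.lt_of_three_le {n : ℕ} {f : ℕ → Vert F} (h : IsClosedSeq n f) (hn : 3 ≤ n) :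
    6 < n := by
  by_contra! hn'
  obtain ⟨m, x, y, z, hm⟩ := h.exists_pt
  have p0 := h.per m
  have p1 := h.per (m + 1)
  have key {k : ℕ} {x y z x' y' z' : F} (h1 : f k = pt x y z) (h2 : f (k + 2) = pt x' y' z') :
      False :=
    (h.shift k).not_pt_pt_of_le_six hn hn' (by simpa using h1) (by simpa [add_comm] using h2)
  obtain ⟨i, c, t, x', y', z', e1, e2, r⟩ | ⟨z', e1, e2, r⟩ |
    ⟨i, c, t, x', y', z', e1, e2, e3, hi, r⟩ | ⟨x', y', e1, e2, e3, e4, r⟩ |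
    ⟨y', z', e1, e2, e3, e4, r⟩ | ⟨x', y', e1, e2, e3, e4, e5⟩ |
    ⟨y', z', e1, e2, e3, e4, e5⟩ := h.segment hm
  · exact key hm e2
  · exact key hm e2
  · interval_cases n
    · grind
    · exact h.not_pt_pt e3 (p0.trans hm)
    · exact key e3 (p0.trans hm)
    · have n5 := h.ne (m + 5)
      obtain ⟨_, _, _, _, _, _, _, e, _⟩ | ⟨_, _, e, _⟩ |
        ⟨j, d, s, u, v, w, e4, e5, e6, hj, r'⟩ | ⟨_, _, _, _, e, _⟩ |
        ⟨_, _, _, _, e, _⟩ | ⟨_, _, _, _, e, _⟩ | ⟨_, _, _, _, e, _⟩ := h.segment e3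
      · exact key e3 e
      · exact key e3 e
      all_goals simp only [add_assoc, Nat.reduceAdd] at *
      · obtain ⟨rfl, rfl, rfl⟩ : x = u ∧ y = v ∧ z = w := by simpa [p0, hm] using e6
        have h1 : (i - j) * (x' - x - 1) = 0 := by grind
        have h2 : (i - j) * (i - j) * (x' - x) = 0 := by grind
        have h3 : f (m + 5) ≠ f (m + 1) := p1 ▸ n5
        have h4 : i = j := by grind
        grind
      all_goals grind
  · interval_cases n
    · grind
    · grind
    · exact h.not_pt_pt e4 (p0.trans hm)
    · exact key e4 (p0.trans hm)
  · interval_cases n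
    · grind
    · grind
    · exact h.not_pt_pt e4 (p0.trans hm)
    · exact key e4 (p0.trans hm)
  · interval_cases n
    · grind
    · grind
    · grind
    · exact h.not_pt_pt e5 (p0.trans hm)
  · interval_cases n
    · grind
    · grind
    · grind
    · exact h.not_pt_pt e5 (p0.trans hm)

lemma girth_graph : (graph F).girth = 7 := by
  have hc : ∃ w : (graph F).Walk (vp (0 : F)) (vp 0), w.IsCycle ∧ w.length = 7 := by
    have e1 : (graph F).Adj (vp 0) (vl 0 0) := by simp [Rel]
    have e2 : (graph F).Adj (vl 0 0) (pt 0 0 0) := by simp [Rel]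
    have e3 : (graph F).Adj (pt 0 0 0) (ln 0 0 0) := by simp [Rel]
    have e4 : (graph F).Adj (ln 0 0 0) (pt 1 0 0) := by simp [Rel]
    have e5 : (graph F).Adj (pt 1 0 0) (vl 1 0) := by simp [Rel]
    have e6 : (graph F).Adj (vl 1 0) (vp 1) := by simp [Rel]
    have e7 : (graph F).Adj (vp 1) (vp 0) := by
      simpa [Rel] using (CharTwo.add_self_eq_zero (1 : F)).symm
    refine ⟨.cons e1 (.cons e2 (.cons e3 (.cons e4 (.cons e5 (.cons e6 (.cons e7 .nil)))))),
      ?_, rfl⟩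
    rw [SimpleGraph.Walk.cons_isCycle_iff]
    simp [SimpleGraph.Walk.isPath_def]
  obtain ⟨w, hw, hl⟩ := hc
  refine le_antisymm (hl ▸ SimpleGraph.girth_le_length hw) ?_
  obtain ⟨a, p, hp, hg⟩ := SimpleGraph.exists_girth_eq_length.2 fun h => h w hw
  have h3 := hp.three_le_length
  have hinj := hp.getVert_injOn'
  have hlast : p.getVert p.length = p.getVert 0 := by simp
  set n := p.length with hn
  have hmod (k : ℕ) : (k + 1) % n = k % n + 1 ∨ (k % n + 1 = n ∧ (k + 1) % n = 0) := by
    rw [Nat.add_mod, Nat.mod_eq_of_lt (show 1 < n by lia)]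
    have := Nat.mod_lt k (show 0 < n by lia)
    rcases Nat.lt_or_ge (k % n + 1) n with h | h
    · exact .inl (Nat.mod_eq_of_lt h)
    · have h : k % n + 1 = n := by lia
      exact .inr ⟨h, by simp [h]⟩
  have hseq : IsClosedSeq n fun k => p.getVert (k % n) :=
    { rel := fun k => by
        have hlt := Nat.mod_lt k (show 0 < n by lia)
        have h := p.adj_getVert_succ hlt
        rcases hmod k with h' | ⟨h', h''⟩
        · simpa only [h', graph_adj] using h
        · simpa only [h'', h', hlast, graph_adj] using h
      ne := fun k h => by
        have hlt := Nat.mod_lt k (show 0 < n by lia)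
        have hlt' := Nat.mod_lt (k + 2) (show 0 < n by lia)
        have := hinj (by simp only [Set.mem_ofPred_eq]; lia) (by simp only [Set.mem_ofPred_eq]; lia) h
        have h1 := hmod k
        have h2 := hmod (k + 1)
        lia
      per := fun k => by simp }
  have := hseq.lt_of_three_le h3
  lia

end Vert

end GirthSeven

/-- Let q ≥ 4 be a power of two. Then there exists a (q+1)-regular graph of girth 7
with exactly 2q³ + q² + 2q vertices. -/
theorem stmt_14 (q : ℕ) (hq : ∃ m : ℕ, q = 2 ^ m) (h4 : 4 ≤ q) :
    ∃ (G : SimpleGraph (Fin (2 * q ^ 3 + q ^ 2 + 2 * q))) (_ : DecidableRel G.Adj),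
      G.IsRegularOfDegree (q + 1) ∧ G.girth = 7 := by
  obtain ⟨m, rfl⟩ := hq
  have hm : m ≠ 0 := by
    rintro rfl
    norm_num at h4
  let F := GaloisField 2 m
  have hF : Nat.card F = 2 ^ m := GaloisField.card 2 m hm
  let e : GirthSeven.Vert F ≃ Fin (2 * (2 ^ m) ^ 3 + (2 ^ m) ^ 2 + 2 * 2 ^ m) :=
    Finite.equivFinOfCardEq (by rw [GirthSeven.Vert.natCard, hF])
  let G := (GirthSeven.Vert.graph F).map e.toEmbedding
  let φ : GirthSeven.Vert.graph F ≃g G := SimpleGraph.Iso.map e _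
  classical
  refine ⟨G, inferInstance, fun v => ?_, φ.girth_eq.symm.trans GirthSeven.Vert.girth_graph⟩
  rw [← SimpleGraph.card_neighborSet_eq_degree, ← Nat.card_eq_fintype_card,
    ← Nat.card_congr (φ.symm.mapNeighborSet v).symm, Nat.card_coe_set_eq,
    GirthSeven.Vert.ncard_neighborSet, hF]
end

section
/- Let q ≥ 5 be an odd prime power. Then there exists a (q+1)-regular graph of girth 7 with exactly 2q^3 + 2q^2 − q + 1 vertices. -/
theorem SimpleGraph.seven_le_egirth_of {V : Type*} (G : SimpleGraph V)
    (h3 : ∀ a b c, G.Adj a b → G.Adj b c → G.Adj c a → False)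
    (h4 : ∀ a b c d, a ≠ c → b ≠ d → G.Adj a b → G.Adj b c → G.Adj c d → G.Adj d a → False)
    (h5 : ∀ a b c d e, a ≠ c → a ≠ d → b ≠ d → b ≠ e → c ≠ e →
      G.Adj a b → G.Adj b c → G.Adj c d → G.Adj d e → G.Adj e a → False)
    (h6 : ∀ a b c d e f, a ≠ c → a ≠ d → a ≠ e → b ≠ d → b ≠ e → b ≠ f → c ≠ e → c ≠ f → d ≠ f →
      G.Adj a b → G.Adj b c → G.Adj c d → G.Adj d e → G.Adj e f → G.Adj f a → False) :
    7 ≤ G.egirth := by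
  rw [le_egirth]
  intro a w hw
  by_contra hlt
  have hlt' : w.length < 7 := by
    rw [not_le] at hlt; exact_mod_cast hlt
  have h3' := hw.three_le_length
  have adj : ∀ i, i < w.length → G.Adj (w.getVert i) (w.getVert (i + 1)) := fun i hi =>
    w.adj_getVert_succ hi
  have hl : w.getVert w.length = a := w.getVert_length
  have h0 : w.getVert 0 = a := w.getVert_zero
  have ne : ∀ i j, i < w.length → j < w.length → i ≠ j → w.getVert i ≠ w.getVert j := by
    intro i j hi hj hij h
    exact hij (hw.getVert_injOn' (by simp; omega) (by simp; omega) h)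
  generalize hn : w.length = n at *
  interval_cases n
  · exact h3 _ _ _ (adj 0 (by simp)) (adj 1 (by simp)) (by simpa [hl, h0] using adj 2 (by simp))
  · exact h4 _ _ _ _ (ne 0 2 (by simp) (by simp) (by simp)) (ne 1 3 (by simp) (by simp) (by simp))
      (adj 0 (by simp)) (adj 1 (by simp)) (adj 2 (by simp))
      (by simpa [hl, h0] using adj 3 (by simp))
  · apply h5 (w.getVert 0) (w.getVert 1) (w.getVert 2) (w.getVert 3) (w.getVert 4)
    any_goals exact ne _ _ (by simp) (by simp) (by simp)
    any_goals exact adj _ (by simp)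
    simpa [hl, h0] using adj 4 (by simp)
  · apply h6 (w.getVert 0) (w.getVert 1) (w.getVert 2) (w.getVert 3) (w.getVert 4) (w.getVert 5)
    any_goals exact ne _ _ (by simp) (by simp) (by simp)
    any_goals exact adj _ (by simp)
    simpa [hl, h0] using adj 5 (by simp)

/-- Conditions on a bipartite relation `B` of girth at least 8 and on a relation `A` within the
colour classes of `P` under which the union of `A` and `B` has girth at least 7. -/
structure AugmentedBipartite {V : Type*} (A B : V → V → Prop) (P : V → Prop) : Prop where
  A_symm : ∀ {u v}, A u v → A v u
  B_symm : ∀ {u v}, B u v → B v u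
  A_color : ∀ {u v}, A u v → (P u ↔ P v)
  B_color : ∀ {u v}, B u v → (P u ↔ ¬ P v)
  no4 : ∀ {a l b m}, B a l → B l b → B b m → B m a → a = b ∨ l = m
  no6 : ∀ {a l b m c n}, B a l → B l b → B b m → B m c → B c n → B n a → a = b ∨ b = c ∨ l = m
  A_irrefl : ∀ {u}, ¬ A u u
  A_path : ∀ {a b c d}, A a b → A b c → A c d → a = c ∨ b = d
  AB2 : ∀ {u v l}, A u v → B v l → B l u → False
  AB4 : ∀ {u v l w m}, A u v → B v l → B l w → B w m → B m u → False
  AAB2 : ∀ {u s v l}, A u s → A s v → u ≠ v → B v l → B l u → False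
  AAB4 : ∀ {u s v l w m}, A u s → A s v → u ≠ v → B v l → B l w → B w m → B m u → False
  ABBABB : ∀ {u v l v' u' m}, A u v → B v l → B l v' → A v' u' → B u' m → B m u → u = u'
  ABA : ∀ {u v l m}, A u v → B v l → ¬ A l m

namespace AugmentedBipartite
variable {V : Type*} {A B : V → V → Prop} {P : V → Prop}

theorem no_triangle (h : AugmentedBipartite A B P)
    {a b c : V} (h1 : A a b ∨ B a b) (h2 : A b c ∨ B b c) (h3 : A c a ∨ B c a) :
    False := by
  have := @h.A_color
  have := @h.B_color
  rcases h1 with h1 | h1 <;> rcases h2 with h2 | h2 <;> rcases h3 with h3 | h3 <;>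
   first
   | exact h.AB2 h1 h2 h3
   | exact h.AB2 h2 h3 h1
   | exact h.AB2 h3 h1 h2
   | exact (h.A_path h1 h2 h3).elim (fun e => h.A_irrefl (e ▸ h3)) (fun e => h.A_irrefl (e ▸ h1))
   | grind only

theorem no_quadrilateral (h : AugmentedBipartite A B P)
    {a b c d : V} (hac : a ≠ c) (hbd : b ≠ d) (h1 : A a b ∨ B a b)
    (h2 : A b c ∨ B b c) (h3 : A c d ∨ B c d) (h4 : A d a ∨ B d a) : False := by
  have hA := @h.A_color
  have hB := @h.B_color
  rcases h1 with h1 | h1 <;> rcases h2 with h2 | h2 <;> rcases h3 with h3 | h3 <;>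
    rcases h4 with h4 | h4 <;>
  first
  | (exfalso; clear hac hbd; grind only)
  | exact (h.no4 h1 h2 h3 h4).elim (fun e => hac e) (fun e => hbd e)
  | exact (h.A_path h1 h2 h3).elim (fun e => hac e) (fun e => hbd e)
  | exact h.ABA h1 h2 h3
  | exact h.ABA h2 h3 h4
  | exact h.AAB2 h1 h2 hac h3 h4
  | exact h.AAB2 h2 h3 hbd h4 h1
  | exact h.AAB2 h3 h4 hac.symm h1 h2
  | exact h.AAB2 h4 h1 hbd.symm h2 h3

theorem no_pentagon (h : AugmentedBipartite A B P)
    {a b c d e : V} (hac : a ≠ c) (had : a ≠ d) (hbd : b ≠ d) (hbe : b ≠ e)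
    (hce : c ≠ e) (h1 : A a b ∨ B a b) (h2 : A b c ∨ B b c) (h3 : A c d ∨ B c d)
    (h4 : A d e ∨ B d e) (h5 : A e a ∨ B e a) : False := by
  have hA := @h.A_color
  have hB := @h.B_color
  rcases h1 with h1 | h1 <;> rcases h2 with h2 | h2 <;> rcases h3 with h3 | h3 <;>
    rcases h4 with h4 | h4 <;> rcases h5 with h5 | h5 <;>
  first
  | (exfalso; clear hac had hbd hbe hce; grind only)
  | exact (h.A_path h1 h2 h3).elim (fun e => hac e) (fun e => hbd e)
  | exact (h.A_path h2 h3 h4).elim (fun e => hbd e) (fun e => hce e)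
  | exact (h.A_path h3 h4 h5).elim (fun e => hce e) (fun e => had e.symm)
  | exact (h.A_path h4 h5 h1).elim (fun e => had e.symm) (fun e => hbe e.symm)
  | exact (h.A_path h5 h1 h2).elim (fun e => hbe e.symm) (fun e => hac e)
  | exact h.ABA h1 h2 h3
  | exact h.ABA h2 h3 h4
  | exact h.ABA h3 h4 h5
  | exact h.ABA h4 h5 h1
  | exact h.ABA h5 h1 h2
  | exact h.AB4 h1 h2 h3 h4 h5
  | exact h.AB4 h2 h3 h4 h5 h1
  | exact h.AB4 h3 h4 h5 h1 h2
  | exact h.AB4 h4 h5 h1 h2 h3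
  | exact h.AB4 h5 h1 h2 h3 h4

theorem no_hexagon (h : AugmentedBipartite A B P)
    {a b c d e f : V} (hac : a ≠ c) (hae : a ≠ e) (hbd : b ≠ d)
    (hbf : b ≠ f) (hce : c ≠ e) (hdf : d ≠ f) (h1 : A a b ∨ B a b)
    (h2 : A b c ∨ B b c) (h3 : A c d ∨ B c d) (h4 : A d e ∨ B d e) (h5 : A e f ∨ B e f)
    (h6 : A f a ∨ B f a) : False := by
  have hA := @h.A_color
  have hB := @h.B_color
  rcases h1 with h1 | h1 <;> rcases h2 with h2 | h2 <;> rcases h3 with h3 | h3 <;>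
    rcases h4 with h4 | h4 <;> rcases h5 with h5 | h5 <;> rcases h6 with h6 | h6 <;>
  first
  | exact (h.A_path h1 h2 h3).elim (fun e => hac e) (fun e => hbd e)
  | exact (h.A_path h2 h3 h4).elim (fun e => hbd e) (fun e => hce e)
  | exact (h.A_path h3 h4 h5).elim (fun e => hce e) (fun e => hdf e)
  | exact (h.A_path h4 h5 h6).elim (fun e => hdf e) (fun e => hae e.symm)
  | exact (h.A_path h5 h6 h1).elim (fun e => hae e.symm) (fun e => hbf e.symm)
  | exact (h.A_path h6 h1 h2).elim (fun e => hbf e.symm) (fun e => hac e)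
  | exact h.ABA h1 h2 h3
  | exact h.ABA h2 h3 h4
  | exact h.ABA h3 h4 h5
  | exact h.ABA h4 h5 h6
  | exact h.ABA h5 h6 h1
  | exact h.ABA h6 h1 h2
  | exact (h.no6 h1 h2 h3 h4 h5 h6).elim hac (fun e => e.elim hce hbd)
  | exact h.AAB4 h1 h2 hac h3 h4 h5 h6
  | exact h.AAB4 h2 h3 hbd h4 h5 h6 h1
  | exact h.AAB4 h3 h4 hce h5 h6 h1 h2
  | exact h.AAB4 h4 h5 hdf h6 h1 h2 h3
  | exact h.AAB4 h5 h6 hae.symm h1 h2 h3 h4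
  | exact h.AAB4 h6 h1 hbf.symm h2 h3 h4 h5
  | exact hae (h.ABBABB h1 h2 h3 h4 h5 h6)
  | exact hbf (h.ABBABB h2 h3 h4 h5 h6 h1)
  | exact hac (h.ABBABB h3 h4 h5 h6 h1 h2).symm
  | (exfalso; clear hac hae hbd hbf hce hdf; grind only)

theorem seven_le_egirth (h : AugmentedBipartite A B P)
    {G : SimpleGraph V} (hG : ∀ a b, G.Adj a b → A a b ∨ B a b) :
    7 ≤ G.egirth :=
  G.seven_le_egirth_of
    (fun _ _ _ h1 h2 h3 => h.no_triangle (hG _ _ h1) (hG _ _ h2) (hG _ _ h3))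
    (fun _ _ _ _ n1 n2 h1 h2 h3 h4 =>
      h.no_quadrilateral n1 n2 (hG _ _ h1) (hG _ _ h2) (hG _ _ h3) (hG _ _ h4))
    (fun _ _ _ _ _ n1 n2 n3 n4 n5 h1 h2 h3 h4 h5 =>
      h.no_pentagon n1 n2 n3 n4 n5 (hG _ _ h1) (hG _ _ h2) (hG _ _ h3) (hG _ _ h4) (hG _ _ h5))
    (fun _ _ _ _ _ _ n1 _ n3 n4 _ n6 n7 _ n9 h1 h2 h3 h4 h5 h6 =>
      h.no_hexagon n1 n3 n4 n6 n7 n9 (hG _ _ h1) (hG _ _ h2) (hG _ _ h3) (hG _ _ h4)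
        (hG _ _ h5) (hG _ _ h6))

end AugmentedBipartite

/-- Homogeneous descriptions of the points and lines of the symplectic quadrangle on `F² × F²`
with form `det - det`. Points: `pt p x y` is spanned by `(dir p, (x, y))` and `sp i` by
`(0, dir i)`. Lines: `gl a b c d` is the graph of the matrix with columns `(a, b)` and `(c, d)`
and `sl i p` is the span of `(0, dir i)` and `(dir p, 0)`. -/
inductive Vtx (F : Type*) where
  | pt (p : Option F) (x y : F)
  | sp (i : Option F)
  | gl (a b c d : F)
  | sl (i p : Option F)

namespace Vtx
variable {F : Type*} [Field F]

/-- First coordinate of the direction indexed by an element of the projective line. -/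
def dx : Option F → F
  | none => 1
  | some t => t

/-- Second coordinate of the direction indexed by an element of the projective line. -/
def dy : Option F → F
  | none => 0
  | some _ => 1

@[simp] theorem dx_none : dx (none : Option F) = 1 := rfl
@[simp] theorem dy_none : dy (none : Option F) = 0 := rfl
@[simp] theorem dx_some (t : F) : dx (some t) = t := rfl
@[simp] theorem dy_some (t : F) : dy (some t) = 1 := rfl

/-- Being a point (rather than a line) of the quadrangle. -/
def IsPoint : Vtx F → Prop
  | pt _ _ _ => True
  | sp _ => True
  | gl _ _ _ _ => False
  | sl _ _ => False

/-- Graph lines are totally isotropic when the matrix has determinant one. -/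
def Nondeg : Vtx F → Prop
  | gl a b c d => a * d - b * c = 1
  | _ => True

/-- Incidence of a point with a line. -/
def Inc : Vtx F → Vtx F → Prop
  | pt p x y, gl a b c d => x = dx p * a + dy p * c ∧ y = dx p * b + dy p * d
  | pt p x y, sl i r => p = r ∧ x * dy i = y * dx i
  | sp i, sl j _ => i = j
  | _, _ => False

/-- First coordinate of the vector spanning a point. -/
def co1 : Vtx F → F
  | pt p _ _ => dx p
  | _ => 0

/-- Second coordinate of the vector spanning a point. -/
def co2 : Vtx F → F
  | pt p _ _ => dy p
  | _ => 0

/-- Third coordinate of the vector spanning a point. -/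
def co3 : Vtx F → F
  | pt _ x _ => x
  | sp i => dx i
  | _ => 0

/-- Fourth coordinate of the vector spanning a point. -/
def co4 : Vtx F → F
  | pt _ _ y => y
  | sp i => dy i
  | _ => 0

/-- The symplectic form defining the quadrangle. -/
def form (a b : Vtx F) : F :=
  co1 a * co2 b - co2 a * co1 b - (co3 a * co4 b - co4 a * co3 b)

theorem Inc.isPoint {a l : Vtx F} (h : Inc a l) : IsPoint a := by
  cases a <;> cases l <;> simp_all [Inc, IsPoint]

theorem Inc.not_isPoint {a l : Vtx F} (h : Inc a l) : ¬ IsPoint l := by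
  cases a <;> cases l <;> simp_all [Inc, IsPoint]

theorem dir_par {i j : Option F} (h : dx i * dy j = dy i * dx j) : i = j := by
  rcases i with _ | i <;> rcases j with _ | j <;> simp_all [dx, dy]

theorem par_det {i : Option F} {x y u v : F} (h : x * dy i = y * dx i)
    (h' : u * dy i = v * dx i) : x * v = y * u := by
  rcases i with _ | i <;> simp only [dx_none, dy_none, dx_some, dy_some] at h h' <;> grind

theorem Inc.form_eq_zero {a b l : Vtx F} (hl : Nondeg l) (ha : Inc a l) (hb : Inc b l) :
    form a b = 0 := by
  cases l with
  | pt => cases a <;> simp [Inc] at ha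
  | sp => cases a <;> simp [Inc] at ha
  | gl =>
    cases a <;> simp only [Inc] at ha
    cases b <;> simp only [Inc] at hb
    simp only [Nondeg] at hl
    simp only [form, co1, co2, co3, co4]
    grind
  | sl i r =>
    cases a <;> cases b <;> rcases i with _ | i <;> rcases r with _ | r <;>
      simp_all [Inc, form, co1, co2, co3, co4, dx, dy] <;> grind [dx, dy]

theorem Inc.unique {a b l m : Vtx F} (hal : Inc a l) (hbl : Inc b l) (ham : Inc a m)
    (hbm : Inc b m) : a = b ∨ l = m := by
  cases l with
  | pt => cases a <;> simp [Inc] at hal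
  | sp => cases a <;> simp [Inc] at hal
  | gl =>
    cases a <;> simp only [Inc] at hal
    cases b <;> simp only [Inc] at hbl
    rename_i p _ _ r _ _
    cases m <;> simp only [Inc] at ham hbm
    · rcases p with _ | p <;> rcases r with _ | r <;> simp_all
      grind
    · grind
  | sl i r =>
    cases m with
    | pt => cases a <;> simp [Inc] at ham
    | sp => cases a <;> simp [Inc] at ham
    | gl => cases a <;> cases b <;> simp_all [Inc]
    | sl j s =>
      cases a <;> simp only [Inc] at hal ham <;> cases b <;> simp only [Inc] at hbl hbm
      · by_cases hij : i = j
        · grind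
        · rename_i p x y p' x' y'
          have key : ∀ {x y : F}, x * dy i = y * dx i → x * dy j = y * dx j → x = 0 ∧ y = 0 := by
            intro x y h h'
            by_contra hne
            apply hij
            apply dir_par
            rcases i with _ | i <;> rcases j with _ | j <;>
              simp only [dx_none, dy_none, dx_some, dy_some] at * <;> grind
          have := key hal.2 ham.2
          have := key hbl.2 hbm.2
          grind
      all_goals grind

theorem inc_of_form {a b c l : Vtx F} (hl : Nondeg l) (hc : IsPoint c) (ha : Inc a l)
    (hb : Inc b l) (hab : a ≠ b) (hca : form c a = 0) (hcb : form c b = 0) : Inc c l := by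
  cases l with
  | pt => cases a <;> simp [Inc] at ha
  | sp => cases a <;> simp [Inc] at ha
  | gl =>
    cases a <;> simp only [Inc] at ha
    cases b <;> simp only [Inc] at hb
    rename_i p _ _ r _ _
    simp only [Nondeg] at hl
    cases c <;> simp only [IsPoint] at hc
    · simp only [form, co1, co2, co3, co4] at hca hcb
      simp only [Inc]
      rename_i s _ _
      rcases p with _ | p <;> rcases r with _ | r <;> rcases s with _ | s <;> simp_all <;> grind
    · simp only [form, co1, co2, co3, co4] at hca hcb
      simp only [Inc]
      rename_i s
      rcases p with _ | p <;> rcases r with _ | r <;> rcases s with _ | s <;> simp_all <;> grind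
  | sl i t =>
    cases a <;> simp only [Inc] at ha <;> cases b <;> simp only [Inc] at hb <;>
      cases c <;> simp only [IsPoint] at hc <;>
      simp only [form, co1, co2, co3, co4] at hca hcb <;> simp only [Inc]
    · rename_i p x y p' x' y' r u v
      obtain ⟨rfl, ha⟩ := ha
      obtain ⟨rfl, hb⟩ := hb
      have hab : ¬ (x = x' ∧ y = y') := fun h => hab (by rw [h.1, h.2])
      have h1 : u * dy i = v * dx i := by
        rcases i with _ | i <;> simp only [dx_none, dy_none, dx_some, dy_some] at * <;> grind
      refine ⟨dir_par ?_, h1⟩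
      linear_combination hca + par_det h1 ha
    · rename_i p x y p' x' y' r
      obtain ⟨rfl, ha⟩ := ha
      obtain ⟨rfl, hb⟩ := hb
      have hab : ¬ (x = x' ∧ y = y') := fun h => hab (by rw [h.1, h.2])
      refine dir_par ?_
      rcases i with _ | i <;> simp only [dx_none, dy_none, dx_some, dy_some] at * <;> grind
    · subst hb
      have h1 := (sub_eq_zero.1 (neg_eq_zero.1 (by simpa using hcb))).symm
      refine ⟨ha.1 ▸ dir_par ?_, h1⟩
      linear_combination hca + par_det h1 ha.2
    · subst hb
      exact dir_par (by linear_combination - hcb)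
    · subst ha
      have h1 := (sub_eq_zero.1 (neg_eq_zero.1 (by simpa using hca))).symm
      refine ⟨hb.1 ▸ dir_par ?_, h1⟩
      linear_combination hcb + par_det h1 hb.2
    · subst ha
      exact dir_par (by linear_combination - hca)
    · exact absurd (by rw [ha, hb]) hab
    · exact absurd (by rw [ha, hb]) hab

theorem Inc.no_triangle {a b c l m n : Vtx F} (hl : Nondeg l) (hm : Nondeg m) (hn : Nondeg n)
    (hal : Inc a l) (hbl : Inc b l) (hbm : Inc b m) (hcm : Inc c m) (hcn : Inc c n)
    (han : Inc a n) : a = b ∨ b = c ∨ l = m := by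
  by_contra! h
  have := inc_of_form hl hcm.isPoint hal hbl h.1 (Inc.form_eq_zero hn hcn han)
    (Inc.form_eq_zero hm hcm hbm)
  rcases Inc.unique hbl this hbm hcm with h' | h'
  · exact h.2.1 h'
  · exact h.2.2 h'

end Vtx

/-- The auxiliary perfect matchings used to complete the truncated quadrangle. -/
structure MatchingData (F : Type*) [Field F] where
  /-- Indices of the points `sp i` that are kept. -/
  K : Finset (Option F)
  /-- The matching of the lines through a deleted point `sp i`. -/
  σ : Option F → F → F
  /-- The scaling that defines the matching on the neighbours of the point `pt (some 0) 0 0`. -/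
  μ : F → F → F
  zero_notMem : some 0 ∉ K
  σ_ne_zero : ∀ i ∉ K, ∀ c ≠ 0, σ i c ≠ 0
  σ_ne : ∀ i ∉ K, ∀ c ≠ 0, σ i c ≠ c
  σ_σ : ∀ i ∉ K, ∀ c ≠ 0, σ i (σ i c) = c
  σ_inj : ∀ i ∉ K, ∀ j ∉ K, ∀ c ≠ 0, σ i c = σ j c → i = j
  μ_ne_zero : ∀ x y, μ x y ≠ 0
  μ_ne_one : ∀ x y, μ x y ≠ 1
  μ_ne_neg_one : ∀ x y, μ x y ≠ -1
  μ_μ : ∀ x y, x ≠ 0 ∨ y ≠ 0 → μ (μ x y * x) (μ x y * y) * μ x y = 1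

namespace MatchingData
open Vtx
variable {F : Type*} [Field F] (D : MatchingData F)

/-- The vertices that are not deleted. -/
def Valid : Vtx F → Prop
  | pt p x y => p = none ∨ p = some 0 → x ≠ 0 ∨ y ≠ 0
  | sp i => i ∈ D.K
  | gl a b c d => a * d - b * c = 1
  | sl _ r => r ≠ none ∧ r ≠ some 0

/-- The vector `(x, y)` is, up to sign, the kept direction `i`. -/
def Special (x y : F) (i : Option F) : Prop :=
  i ∈ D.K ∧ (x = dx i ∧ y = dy i ∨ x = -dx i ∧ y = -dy i)

/-- The added edges. -/
def Added : Vtx F → Vtx F → Prop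
  | pt none x y, pt none x' y' => x' = -x ∧ y' = -y ∧ ∀ i, ¬ D.Special x y i
  | pt none x y, sp i => D.Special x y i
  | sp i, pt none x y => D.Special x y i
  | pt (some t) x y, pt (some s) x' y' =>
    t = 0 ∧ s = 0 ∧ x' = D.μ x y * x ∧ y' = D.μ x y * y
  | sl i r, sl j s => i = j ∧ i ∉ D.K ∧ ∃ c, r = some c ∧ s = some (D.σ i c)
  | _, _ => False

theorem valid_nondeg {v : Vtx F} (h : D.Valid v) : Nondeg v := by
  cases v <;> simp_all [Valid, Nondeg]

theorem exists_par (x y : F) : ∃ i : Option F, x * dy i = y * dx i := by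
  by_cases h : y = 0
  · exact ⟨none, by simp [h]⟩
  · exact ⟨some (x / y), by simp; field_simp⟩

variable {D}

theorem Special.neg {x y : F} {i : Option F} (h : D.Special x y i) : D.Special (-x) (-y) i := by
  refine ⟨h.1, ?_⟩
  rcases h.2 with ⟨rfl, rfl⟩ | ⟨rfl, rfl⟩ <;> simp

theorem Special.par {x y : F} {i : Option F} (h : D.Special x y i) : x * dy i = y * dx i := by
  rcases h.2 with ⟨rfl, rfl⟩ | ⟨rfl, rfl⟩ <;> ring

theorem Special.unique {x y : F} {i j : Option F} (h : D.Special x y i) (h' : D.Special x y j) :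
    i = j := by
  apply dir_par
  have := h'.par
  rcases h.2 with ⟨rfl, rfl⟩ | ⟨rfl, rfl⟩
  · exact this
  · linear_combination -this

theorem Added.symm {u v : Vtx F} (hu : D.Valid u) (h : D.Added u v) : D.Added v u := by
  rcases u with ⟨_ | t, x, y⟩ | i | _ | ⟨i, r⟩ <;>
    rcases v with ⟨_ | s, x', y'⟩ | j | _ | ⟨j, r'⟩ <;>
    simp only [Added] at h ⊢
  · obtain ⟨rfl, rfl, h⟩ := h
    exact ⟨by simp, by simp, fun i hi => h i (by simpa using hi.neg)⟩
  · exact h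
  · obtain ⟨rfl, rfl, rfl, rfl⟩ := h
    have := D.μ_μ x y (hu (Or.inr rfl))
    refine ⟨rfl, rfl, ?_, ?_⟩ <;> grind
  · exact h
  · obtain ⟨rfl, hi, c, rfl, rfl⟩ := h
    have hc : c ≠ 0 := fun h => hu.2 (by rw [h])
    exact ⟨rfl, hi, _, rfl, by rw [D.σ_σ i hi c hc]⟩

theorem Added.isPoint_iff {u v : Vtx F} (h : D.Added u v) : IsPoint u ↔ IsPoint v := by
  rcases u with ⟨_ | t, x, y⟩ | i | _ | ⟨i, r⟩ <;>
    rcases v with ⟨_ | s, x', y'⟩ | j | _ | ⟨j, r'⟩ <;>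
    simp_all [Added, IsPoint]

theorem Added.ne (h2 : (2 : F) ≠ 0) {u v : Vtx F} (hu : D.Valid u) (h : D.Added u v) : u ≠ v := by
  rcases u with ⟨_ | t, x, y⟩ | i | _ | ⟨i, r⟩ <;>
    rcases v with ⟨_ | s, x', y'⟩ | j | _ | ⟨j, r'⟩ <;>
    simp only [Added] at h <;> try simp
  · have := hu (Or.inl rfl)
    grind
  · have := hu
    simp only [Valid] at this
    have := D.μ_ne_one x y
    grind
  · obtain ⟨rfl, hi, c, rfl, rfl⟩ := h
    have hc : c ≠ 0 := fun h => hu.2 (by rw [h])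
    have := D.σ_ne i hi c hc
    grind

/-- Apart from the kept points `sp i`, every vertex is on at most one added edge. -/
theorem Added.unique {s u v : Vtx F} (hs : ∀ i, s ≠ sp i) (h : D.Added s u) (h' : D.Added s v) :
    u = v := by
  rcases s with ⟨_ | t, x, y⟩ | i | _ | ⟨i, r⟩
  · rcases u with ⟨_ | s, x', y'⟩ | j | _ | _ <;> simp only [Added] at h <;>
      rcases v with ⟨_ | s, x', y'⟩ | j | _ | _ <;> simp only [Added] at h'
    · rw [h.1, h.2.1, h'.1, h'.2.1]
    · exact absurd h' (h.2.2 _)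
    · exact absurd h (h'.2.2 _)
    · rw [h.unique h']
  · rcases u with ⟨_ | s, x', y'⟩ | j | _ | _ <;> simp only [Added] at h
    rcases v with ⟨_ | s, x', y'⟩ | j | _ | _ <;> simp only [Added] at h'
    grind
  · exact absurd rfl (hs i)
  · cases u <;> simp [Added] at h
  · cases u <;> simp only [Added] at h
    cases v <;> simp only [Added] at h'
    grind

theorem Added.sp_left {i : Option F} {u : Vtx F} (h : D.Added (sp i) u) :
    ∃ x y, u = pt none x y ∧ D.Special x y i := by
  rcases u with ⟨_ | s, x', y'⟩ | j | _ | _ <;> simp only [Added] at h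
  exact ⟨_, _, rfl, h⟩

/-- The incidence graph of the quadrangle. -/
def Flag (u v : Vtx F) : Prop := Inc u v ∨ Inc v u

/-- The elements `u` and `v` are both incident with a deleted element. -/
def Close (D : MatchingData F) (u v : Vtx F) : Prop :=
  u ≠ v ∧ ∃ d, ¬ D.Valid d ∧ Nondeg d ∧ Flag u d ∧ Flag v d

theorem Added.close (h2 : (2 : F) ≠ 0) {u v : Vtx F} (hu : D.Valid u) (h : D.Added u v) :
    D.Close u v := by
  refine ⟨h.ne h2 hu, ?_⟩
  rcases u with ⟨_ | t, x, y⟩ | i | _ | ⟨i, r⟩ <;>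
    rcases v with ⟨_ | s, x', y'⟩ | j | _ | ⟨j, r'⟩ <;>
    simp only [Added] at h
  · obtain ⟨i, hi⟩ := exists_par x y
    exact ⟨sl i none, by simp [Valid], trivial, by simp [Flag, Inc, hi],
      by simp [Flag, Inc, hi, h.1, h.2.1]⟩
  · exact ⟨sl j none, by simp [Valid], trivial, by simp [Flag, Inc, h.par], by simp [Flag, Inc]⟩
  · obtain ⟨rfl, rfl, rfl, rfl⟩ := h
    obtain ⟨i, hi⟩ := exists_par x y
    exact ⟨sl i (some 0), by simp [Valid], trivial, by simp [Flag, Inc, hi],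
      by simp [Flag, Inc, mul_assoc, hi]⟩
  · exact ⟨sl i none, by simp [Valid], trivial, by simp [Flag, Inc], by simp [Flag, Inc, h.par]⟩
  · exact ⟨sp i, by simp [Valid, h.2.1], trivial, by simp [Flag, Inc], by simp [Flag, Inc, h.1]⟩

theorem Added.close_of_common {u s v : Vtx F} (hs : D.Valid s)
    (hu : D.Valid u) (h : D.Added u s) (h' : D.Added s v) (hne : u ≠ v) : D.Close u v := by
  refine ⟨hne, ?_⟩
  have h := h.symm hu
  by_cases hsp : ∃ i, s = sp i
  · obtain ⟨i, rfl⟩ := hsp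
    obtain ⟨x, y, rfl, hx⟩ := h.sp_left
    obtain ⟨x', y', rfl, hx'⟩ := h'.sp_left
    exact ⟨sl i none, by simp [Valid], trivial, by simp [Flag, Inc, hx.par],
      by simp [Flag, Inc, hx'.par]⟩
  · exact absurd (h.unique (by simpa using hsp) h') hne

theorem Flag.symm {u v : Vtx F} (h : Flag u v) : Flag v u := Or.symm h

theorem Flag.isPoint_iff {u v : Vtx F} (h : Flag u v) : IsPoint u ↔ ¬ IsPoint v := by
  rcases h with h | h
  · exact iff_of_true h.isPoint h.not_isPoint
  · exact iff_of_false h.not_isPoint (not_not.2 h.isPoint)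

theorem Flag.inc {u v : Vtx F} (h : Flag u v) (hu : IsPoint u) : Inc u v :=
  h.resolve_right fun h => h.not_isPoint hu

theorem Flag.inc' {u v : Vtx F} (h : Flag u v) (hu : ¬ IsPoint u) : Inc v u :=
  h.resolve_left fun h => hu h.isPoint

theorem Flag.unique {a l b m : Vtx F} (h1 : Flag a l) (h2 : Flag l b) (h3 : Flag b m)
    (h4 : Flag m a) : a = b ∨ l = m := by
  by_cases ha : IsPoint a
  · have hl := h1.isPoint_iff.1 ha
    have hm : ¬ IsPoint m := fun h => h4.isPoint_iff.1 h ha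
    exact Inc.unique (h1.inc ha) (h2.inc' hl) (h4.inc' hm) (h3.symm.inc' hm)
  · have hl := not_not.1 (mt h1.isPoint_iff.2 ha)
    have hm := h4.isPoint_iff.2 ha
    exact (Inc.unique (h1.inc' ha) (h4.inc hm) (h2.inc hl) (h3.symm.inc hm)).symm

theorem Flag.no_hexagon {a l b m c n : Vtx F} (va : Nondeg a) (vl : Nondeg l) (vb : Nondeg b)
    (vm : Nondeg m) (vc : Nondeg c) (vn : Nondeg n) (h1 : Flag a l) (h2 : Flag l b)
    (h3 : Flag b m) (h4 : Flag m c) (h5 : Flag c n) (h6 : Flag n a) :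
    a = b ∨ b = c ∨ l = m := by
  by_cases ha : IsPoint a
  · have hl := h1.isPoint_iff.1 ha
    have hn : ¬ IsPoint n := fun h => h6.isPoint_iff.1 h ha
    have hb := h2.symm.isPoint_iff.2 hl
    have hm := h3.isPoint_iff.1 hb
    exact Inc.no_triangle vl vm vn (h1.inc ha) (h2.inc' hl) (h3.inc hb) (h4.inc' hm)
      (h5.symm.inc' hn) (h6.inc' hn)
  · have hl := not_not.1 (mt h1.isPoint_iff.2 ha)
    have hn := h6.isPoint_iff.2 ha
    have hb := h2.isPoint_iff.1 hl
    have hm := not_not.1 (mt h3.isPoint_iff.2 hb)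
    have := Inc.no_triangle vb vc va (h2.inc hl) (h3.inc' hb) (h4.inc hm) (h5.symm.inc hn)
      (h6.inc hn) (h1.inc' ha)
    rcases this with h | h | h
    · exact .inr (.inr h)
    · subst h
      rcases Flag.unique h1 h2 h3 h6 with h | h
      · exact .inl h
      · exact .inr (.inr h)
    · exact .inr (.inl h)

theorem Close.no_common {u v l : Vtx F} (h : D.Close u v) (hl : D.Valid l) (h1 : Flag v l)
    (h2 : Flag l u) : False := by
  obtain ⟨hne, d, hd, -, hud, hvd⟩ := h
  rcases Flag.unique hud hvd.symm h1 h2 with h | h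
  · exact hne h
  · exact hd (h ▸ hl)

theorem Close.no_path {u v l w m : Vtx F} (h : D.Close u v) (hu : D.Valid u) (hv : D.Valid v)
    (hl : D.Valid l) (hw : D.Valid w) (hm : D.Valid m) (h1 : Flag v l) (h2 : Flag l w)
    (h3 : Flag w m) (h4 : Flag m u) : False := by
  have hc := h
  obtain ⟨hne, d, hd, hd', hud, hvd⟩ := h
  rcases Flag.no_hexagon (D.valid_nondeg hu) hd' (D.valid_nondeg hv) (D.valid_nondeg hl)
    (D.valid_nondeg hw) (D.valid_nondeg hm) hud hvd.symm h1 h2 h3 h4 with h | h | h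
  · exact hne h
  · exact hc.no_common hm (h ▸ h3) h4
  · exact hd (h ▸ hl)

theorem Added.path {a b c d : Vtx F} (va : D.Valid a) (vb : D.Valid b)
    (h1 : D.Added a b) (h2 : D.Added b c) (h3 : D.Added c d) : a = c ∨ b = d := by
  by_cases hb : ∃ i, b = sp i
  · obtain ⟨i, rfl⟩ := hb
    obtain ⟨x, y, rfl, hx⟩ := h2.sp_left
    exact .inr (Added.unique (by simp) (h2.symm vb) h3)
  · exact .inl (Added.unique (by simpa using hb) (h1.symm va) h2)

theorem Added.not_flag_added {u v l m : Vtx F} (hu : D.Valid u) (hv : D.Valid v) (hl : D.Valid l)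
    (hm : D.Valid m) (h1 : D.Added u v) (h2 : Flag v l) : ¬ D.Added l m := by
  intro h3
  rcases v with ⟨_ | t, x, y⟩ | i | _ | ⟨i, r⟩ <;>
    rcases l with ⟨_ | s, x', y'⟩ | j | _ | ⟨j, r'⟩ <;>
    simp only [Flag, Inc, or_false, false_or, or_self] at h2 <;>
    rcases u with ⟨_ | t', x1, y1⟩ | i1 | _ | ⟨i1, r1⟩ <;>
    simp only [Added] at h1 <;>
    rcases m with ⟨_ | t', x2, y2⟩ | i2 | _ | ⟨i2, r2⟩ <;>
    simp only [Added] at h3 <;> simp only [Valid] at hv hl <;> grind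

theorem Added.ABBABB {u v l v' u' m : Vtx F} (hu : D.Valid u) (hv : D.Valid v)
    (hl : D.Valid l) (hv' : D.Valid v') (hu' : D.Valid u') (hm : D.Valid m)
    (h : D.Added u v) (h1 : Flag v l) (h3 : Flag l v') (h' : D.Added v' u') (h4 : Flag u' m)
    (h5 : Flag m u) : u = u' := by
  by_contra hne
  by_cases hvv : v = v'
  · subst hvv
    exact (Added.close_of_common hv hu h h' hne).no_common hm h4 h5
  rcases v with ⟨_ | t, x, y⟩ | i | _ | ⟨i, r⟩ <;>
    rcases v' with ⟨_ | s, x', y'⟩ | j | _ | ⟨j, r'⟩ <;>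
    rcases u with ⟨_ | t', x1, y1⟩ | i1 | _ | ⟨i1, r1⟩ <;>
    simp only [Added] at h <;>
    rcases u' with ⟨_ | t', x2, y2⟩ | i2 | _ | ⟨i2, r2⟩ <;>
    simp only [Added] at h' <;>
    rcases l with ⟨_ | s, x3, y3⟩ | i3 | _ | ⟨i3, r3⟩ <;>
    simp only [Flag, Inc, or_false, false_or, or_self] at h1 h3 <;>
    rcases m with ⟨_ | s, x4, y4⟩ | i4 | _ | ⟨i4, r4⟩ <;>
    simp only [Flag, Inc, or_false, false_or, or_self] at h4 h5 <;> simp only [Valid] at hl hm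
  all_goals try grind [dx, dy]
  · obtain ⟨rfl, rfl, rfl, rfl⟩ := h'
    simp only [dx_none, dy_none, dx_some, dy_some] at h1 h3 h4 h5
    refine D.μ_ne_neg_one x' y' ?_
    grind
  · obtain ⟨rfl, rfl, rfl, rfl⟩ := h
    simp only [dx_none, dy_none, dx_some, dy_some] at h1 h3 h4 h5
    refine D.μ_ne_neg_one x1 y1 ?_
    grind
  · obtain ⟨rfl, hi, c, rfl, rfl⟩ := h
    obtain ⟨rfl, hj, c', rfl, rfl⟩ := h'
    have hc : c' ≠ 0 := fun h => hv'.2 (by rw [h])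
    have e1 : c' = D.σ i1 c := by grind
    have e2 : D.σ j c' = c := by grind
    refine hne ?_
    rw [D.σ_inj i1 hi j hj c (by grind [D.σ_ne_zero j hj c' hc])
      (by rw [← e1, ← e2, D.σ_σ j hj c' hc]), e2]

theorem Added.ne_of_valid (h2 : (2 : F) ≠ 0) {u : Vtx F} (hu : D.Valid u) : ¬ D.Added u u :=
  fun h => h.ne h2 hu rfl

variable (D)

/-- The graph obtained from the incidence graph of the quadrangle by deleting vertices and adding
matchings. -/
def graph (h2 : (2 : F) ≠ 0) : SimpleGraph {v : Vtx F // D.Valid v} where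
  Adj u v := D.Added u v ∨ Flag u.1 v.1
  symm := ⟨fun u _ h => h.imp (fun h => h.symm u.2) (fun h => h.symm)⟩
  loopless := ⟨fun u h => h.elim (Added.ne_of_valid h2 u.2)
    (fun h => iff_not_self h.isPoint_iff)⟩

theorem augmentedBipartite (h2 : (2 : F) ≠ 0) :
    AugmentedBipartite (V := {v : Vtx F // D.Valid v}) (fun u v => D.Added u v)
      (fun u v => Flag u.1 v.1) (fun u => IsPoint u.1) where
  A_symm {u _} h := h.symm u.2
  B_symm h := h.symm
  A_color h := h.isPoint_iff
  B_color h := h.isPoint_iff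
  no4 a b c d := by simpa [Subtype.ext_iff] using Flag.unique a b c d
  no6 {a l b m c n} h1 h2 h3 h4 h5 h6 := by
    simpa [Subtype.ext_iff] using Flag.no_hexagon (D.valid_nondeg a.2) (D.valid_nondeg l.2)
      (D.valid_nondeg b.2) (D.valid_nondeg m.2) (D.valid_nondeg c.2) (D.valid_nondeg n.2)
      h1 h2 h3 h4 h5 h6
  A_irrefl {u} := Added.ne_of_valid h2 u.2
  A_path {a b c d} h1 h2 h3 := by
    simpa [Subtype.ext_iff] using Added.path a.2 b.2 h1 h2 h3
  AB2 {u v l} h := (h.close h2 u.2).no_common l.2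
  AB4 {u v l w m} h := (h.close h2 u.2).no_path u.2 v.2 l.2 w.2 m.2
  AAB2 {u s v l} h h' hne :=
    (Added.close_of_common s.2 u.2 h h' (by simpa [Subtype.ext_iff] using hne)).no_common l.2
  AAB4 {u s v l w m} h h' hne :=
    (Added.close_of_common s.2 u.2 h h' (by simpa [Subtype.ext_iff] using hne)).no_path
      u.2 v.2 l.2 w.2 m.2
  ABBABB {u v l v' u' m} h1 h3 h4 h5 h6 h7 :=
    Subtype.ext (h1.ABBABB u.2 v.2 l.2 v'.2 u'.2 m.2 h3 h4 h5 h6 h7)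
  ABA {u v l m} h1 h2 := h1.not_flag_added u.2 v.2 l.2 m.2 h2

theorem seven_le_egirth (h2 : (2 : F) ≠ 0) : 7 ≤ (D.graph h2).egirth :=
  (D.augmentedBipartite h2).seven_le_egirth fun _ _ h => h

theorem exists_isCycle_length_seven (h2 : (2 : F) ≠ 0) : ∃ (a : _) (w : (D.graph h2).Walk a a),
    w.IsCycle ∧ w.length = 7 := by
  let a0 : {v : Vtx F // D.Valid v} := ⟨pt none 0 1, by simp [Valid]⟩
  let a1 : {v : Vtx F // D.Valid v} := ⟨gl 0 1 (-1) 0, by simp [Valid]⟩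
  let a2 : {v : Vtx F // D.Valid v} := ⟨pt (some 0) (-1) 0, by simp [Valid]⟩
  let a3 : {v : Vtx F // D.Valid v} := ⟨gl 2 1 (-1) 0, by simp [Valid]⟩
  let a4 : {v : Vtx F // D.Valid v} := ⟨pt (some 1) 1 1, by simp [Valid]⟩
  let a5 : {v : Vtx F // D.Valid v} := ⟨gl 0 (-1) 1 2, by simp [Valid]⟩
  let a6 : {v : Vtx F // D.Valid v} := ⟨pt none 0 (-1), by simp [Valid]⟩
  have h01 : (D.graph h2).Adj a0 a1 := .inr (.inl (by simp [a0, a1, Inc]))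
  have h12 : (D.graph h2).Adj a1 a2 := .inr (.inr (by simp [a1, a2, Inc]))
  have h23 : (D.graph h2).Adj a2 a3 := .inr (.inl (by simp [a2, a3, Inc]))
  have h34 : (D.graph h2).Adj a3 a4 := .inr (.inr (by simp [a3, a4, Inc]; norm_num))
  have h45 : (D.graph h2).Adj a4 a5 := .inr (.inl (by simp [a4, a5, Inc]; norm_num))
  have h56 : (D.graph h2).Adj a5 a6 := .inr (.inr (by simp [a5, a6, Inc]))
  have h60 : (D.graph h2).Adj a6 a0 := by
    refine .inl ⟨by simp, by simp, fun i hi => D.zero_notMem ?_⟩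
    have := hi.par
    rcases i with _ | i
    · simp at this
    · simp at this
      exact this ▸ hi.1
  have e : (1 : F) ≠ -1 := fun h => h2 (by linear_combination h)
  refine ⟨a0, .cons h01 (.cons h12 (.cons h23 (.cons h34 (.cons h45 (.cons h56
    (.cons h60 .nil)))))), ?_, rfl⟩
  rw [SimpleGraph.Walk.cons_isCycle_iff, SimpleGraph.Walk.isPath_def]
  simp [a0, a1, a2, a3, a4, a5, a6, Subtype.ext_iff, h2.symm, e, e.symm]

theorem girth_graph (h2 : (2 : F) ≠ 0) : (D.graph h2).girth = 7 := by
  obtain ⟨a, w, hw, hl⟩ := D.exists_isCycle_length_seven h2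
  have h1 : (D.graph h2).egirth = 7 :=
    le_antisymm ((SimpleGraph.egirth_le_length hw).trans (by rw [hl]; rfl)) (D.seven_le_egirth h2)
  rw [SimpleGraph.girth, h1]
  rfl

variable {D}

theorem exists_det_eq_one {a b : F} (h : a ≠ 0 ∨ b ≠ 0) : ∃ p r, a * r - b * p = 1 := by
  by_cases ha : a = 0
  · exact ⟨-b⁻¹, 0, by grind⟩
  · exact ⟨0, a⁻¹, by grind⟩

theorem det_eq_one_iff {a b p r : F} (h : a * r - b * p = 1) (c d : F) :
    a * d - b * c = 1 ↔ ∃ t, c = p + t * a ∧ d = r + t * b := by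
  constructor
  · intro h'
    refine ⟨c * r - d * p, ?_, ?_⟩
    · linear_combination (-c) * h + p * h'
    · linear_combination (-d) * h + r * h'
  · rintro ⟨t, rfl, rfl⟩
    linear_combination h

/-- The neighbours of `v` are parametrized bijectively by the projective line. -/
def HasParam (D : MatchingData F) (v : Vtx F) : Prop :=
  ∃ f : Option F → Vtx F, f.Injective ∧
    ∀ w, D.Valid w ∧ (D.Added v w ∨ Flag v w) ↔ ∃ t, f t = w

theorem HasParam.of_elim {v : Vtx F} (n : Vtx F) (g : F → Vtx F) (hg : g.Injective)
    (hn : ∀ t, g t ≠ n)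
    (h : ∀ w, D.Valid w ∧ (D.Added v w ∨ Flag v w) ↔ n = w ∨ ∃ t, g t = w) : HasParam D v := by
  refine ⟨fun t => t.elim n g, ?_, fun w => ?_⟩
  · rintro (_ | s) (_ | t) hst
    · rfl
    · exact absurd hst.symm (hn t)
    · exact absurd hst (hn s)
    · exact congrArg some (hg hst)
  · rw [h]
    constructor
    · rintro (h | ⟨t, h⟩)
      · exact ⟨none, h⟩
      · exact ⟨some t, h⟩
    · rintro ⟨_ | t, h⟩
      · exact .inl h
      · exact .inr ⟨t, h⟩

theorem hasParam_gl {a b c d : F} (hv : a * d - b * c = 1) : HasParam D (gl a b c d) := by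
  refine .of_elim (pt none a b) (fun t => pt (some t) (t * a + c) (t * b + d)) ?_ (by simp) ?_
  · intro s t h
    simp at h
    exact h.1
  · rintro (⟨_ | t, x, y⟩ | i | _ | ⟨i, r⟩) <;> simp [Flag, Inc, Added, Valid]
    · grind
    · grind

theorem hasParam_sl {i r : Option F} (hv : D.Valid (sl i r)) :
    HasParam D (sl i r) := by
  rcases r with _ | c
  · exact absurd rfl hv.1
  have hc : c ≠ 0 := fun h => hv.2 (by rw [h])
  have key : ∀ x y : F, x * dy i = y * dx i ↔ ∃ t, t * dx i = x ∧ t * dy i = y := by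
    intro x y
    rcases i with _ | i <;> simp
    grind
  by_cases hi : i ∈ D.K
  · refine .of_elim (sp i) (fun t => pt (some c) (t * dx i) (t * dy i)) ?_ (by simp) ?_
    · intro s t h
      rcases i with _ | i <;> simp at h <;> grind
    · rintro (⟨_ | t, x, y⟩ | i | _ | ⟨i, r⟩) <;> simp [Flag, Inc, Added, Valid, key] <;> grind
  · refine .of_elim (sl i (some (D.σ i c))) (fun t => pt (some c) (t * dx i) (t * dy i)) ?_
      (by simp) ?_
    · intro s t h
      rcases i with _ | i <;> simp at h <;> grind
    · have := D.σ_ne_zero i hi c hc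
      rintro (⟨_ | t, x, y⟩ | i | _ | ⟨i, r⟩) <;> simp [Flag, Inc, Added, Valid, key] <;> grind

theorem hasParam_sp {i : Option F} (h2 : (2 : F) ≠ 0) (hi : i ∈ D.K) : HasParam D (sp i) := by
  classical
  have hd : dx i ≠ 0 ∨ dy i ≠ 0 := by rcases i with _ | i <;> simp
  refine .of_elim (pt none (-dx i) (-dy i))
    (fun c => if c = 0 then pt none (dx i) (dy i) else sl i (some c)) ?_ ?_ ?_
  · intro s t h
    dsimp at h
    split_ifs at h <;> grind
  · intro t
    have : ¬ (dx i = -dx i ∧ dy i = -dy i) := by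
      rintro ⟨h, h'⟩
      grind
    split_ifs <;> simp [this]
  · rintro (⟨_ | t, x, y⟩ | j | _ | ⟨j, r⟩) <;>
      simp [Flag, Inc, Added, Valid, Special, hi, ite_eq_iff]
    · grind
    · rcases r with _ | r <;> simp

theorem hasParam_pt_none {x y : F} (hv : x ≠ 0 ∨ y ≠ 0) :
    HasParam D (pt none x y) := by
  obtain ⟨p, r, hpr⟩ := exists_det_eq_one hv
  have inj : (fun t => gl x y (p + t * x) (r + t * y)).Injective := by
    intro s t h
    simp at h
    grind
  by_cases hi : ∃ i, D.Special x y i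
  · obtain ⟨i, hi⟩ := hi
    refine .of_elim (sp i) _ inj (by simp) ?_
    rintro (⟨_ | t, x', y'⟩ | j | _ | ⟨j, r⟩) <;>
      simp [Flag, Inc, Added, Valid]
    · exact fun _ _ _ => ⟨_, hi⟩
    · exact ⟨fun h => hi.unique h.2, fun h => h ▸ ⟨hi.1, hi⟩⟩
    · grind [det_eq_one_iff hpr]
    · grind
  · refine .of_elim (pt none (-x) (-y)) _ inj (by simp) ?_
    rintro (⟨_ | t, x', y'⟩ | j | _ | ⟨j, r⟩) <;>
      simp [Flag, Inc, Added, Valid]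
    · grind
    · exact fun _ h => hi ⟨_, h⟩
    · grind [det_eq_one_iff hpr]
    · grind

theorem hasParam_pt_zero {x y : F} (hv : x ≠ 0 ∨ y ≠ 0) :
    HasParam D (pt (some 0) x y) := by
  obtain ⟨p, r, hpr⟩ := exists_det_eq_one hv
  have hμ := D.μ_ne_zero x y
  refine .of_elim (pt (some 0) (D.μ x y * x) (D.μ x y * y))
    (fun t => gl (-(p + t * x)) (-(r + t * y)) x y) ?_ (by simp) ?_
  · intro s t h
    simp at h
    grind
  · rintro (⟨_ | t, x', y'⟩ | j | ⟨a, b, c, d⟩ | ⟨j, r⟩) <;>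
      simp [Flag, Inc, Added, Valid]
    · grind
    · have := det_eq_one_iff hpr (-a) (-b)
      constructor
      · rintro ⟨h, hx, hy⟩
        obtain ⟨s, hs⟩ := this.1 (by rw [hx, hy]; linear_combination h)
        exact ⟨s, by grind⟩
      · rintro ⟨s, hs⟩
        have := this.2 ⟨s, by grind⟩
        grind
    · grind

theorem hasParam_pt_some {t x y : F} (ht : t ≠ 0) (hv : x ≠ 0 ∨ y ≠ 0) :
    HasParam D (pt (some t) x y) := by
  obtain ⟨p, r, hpr⟩ := exists_det_eq_one hv
  obtain ⟨i, hi⟩ := exists_par x y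
  refine .of_elim (sl i (some t))
    (fun s => gl (-(p + s * x)) (-(r + s * y)) (x + t * (p + s * x)) (y + t * (r + s * y)))
    ?_ (by simp) ?_
  · intro s t h
    simp at h
    grind
  · rintro (⟨_ | t, x', y'⟩ | j | ⟨a, b, c, d⟩ | ⟨j, r⟩) <;>
      simp [Flag, Inc, Added, Valid]
    · grind
    · have := det_eq_one_iff hpr (-a) (-b)
      constructor
      · rintro ⟨h, hx, hy⟩
        obtain ⟨s, hs⟩ := this.1 (by rw [hx, hy]; linear_combination h)
        exact ⟨s, by grind⟩
      · rintro ⟨s, hs⟩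
        have := this.2 ⟨s, by grind⟩
        grind
    · have key : x * dy j = y * dx j → i = j := by
        intro h
        refine dir_par ?_
        rcases i with _ | i <;> rcases j with _ | j <;> simp at * <;> grind
      grind

theorem hasParam_pt_some_zero {t : F} (ht : t ≠ 0) : HasParam D (pt (some t) 0 0) := by
  refine ⟨fun i => sl i (some t), fun i j h => by simpa using h, ?_⟩
  rintro (⟨_ | t, x', y'⟩ | j | ⟨a, b, c, d⟩ | ⟨j, r⟩) <;> simp [Flag, Inc, Added, Valid]
  · grind
  · grind
  · grind

theorem hasParam (h2 : (2 : F) ≠ 0) {v : Vtx F} (hv : D.Valid v) : HasParam D v := by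
  rcases v with ⟨_ | t, x, y⟩ | i | _ | ⟨i, r⟩
  · exact hasParam_pt_none (hv (.inl rfl))
  · by_cases ht : t = 0
    · subst ht
      exact hasParam_pt_zero (hv (.inr rfl))
    · by_cases h : x ≠ 0 ∨ y ≠ 0
      · exact hasParam_pt_some ht h
      · obtain ⟨rfl, rfl⟩ := not_or.1 h |>.imp not_not.1 not_not.1
        exact hasParam_pt_some_zero ht
  · exact hasParam_sp h2 hv
  · exact hasParam_gl hv
  · exact hasParam_sl hv

theorem card_neighborSet (D : MatchingData F) (h2 : (2 : F) ≠ 0) (v) :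
    Nat.card ((D.graph h2).neighborSet v) = Nat.card (Option F) := by
  obtain ⟨f, hf, h⟩ := hasParam h2 v.2
  symm
  refine Nat.card_congr (Equiv.ofBijective
    (fun t => ⟨⟨f t, ((h _).2 ⟨t, rfl⟩).1⟩, ((h _).2 ⟨t, rfl⟩).2⟩) ⟨?_, ?_⟩)
  · intro s t hst
    exact hf (congrArg (fun w => w.1.1) hst)
  · rintro ⟨⟨w, hw⟩, hw'⟩
    obtain ⟨t, rfl⟩ := (h w).1 ⟨hw, hw'⟩
    exact ⟨t, rfl⟩

end MatchingData

theorem Nat.card_subtype_notMem {α : Type*} [Finite α] (T : Finset α) :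
    Nat.card {a // a ∉ T} + T.card = Nat.card α := by
  classical
  have := Fintype.ofFinite α
  rw [Nat.card_eq_fintype_card, Nat.card_eq_fintype_card, ← Fintype.card_coe T,
    Fintype.card_subtype_compl]
  exact Nat.sub_add_cancel (Fintype.card_subtype_le _)

/-- The four families of elements of the quadrangle. -/
def Vtx.equivSum (F : Type*) :
    Vtx F ≃ (Option F × F × F) ⊕ Option F ⊕ (F × F × F × F) ⊕ (Option F × Option F) where
  toFun
    | pt p x y => .inl (p, x, y)
    | sp i => .inr (.inl i)
    | gl a b c d => .inr (.inr (.inl (a, b, c, d)))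
    | sl i r => .inr (.inr (.inr (i, r)))
  invFun
    | .inl (p, x, y) => pt p x y
    | .inr (.inl i) => sp i
    | .inr (.inr (.inl (a, b, c, d))) => gl a b c d
    | .inr (.inr (.inr (i, r))) => sl i r
  left_inv := by rintro (_ | _ | _ | _) <;> rfl
  right_inv := by rintro (_ | _ | _ | _) <;> rfl

namespace MatchingData
open Vtx
variable {F : Type*} [Field F] {D : MatchingData F}

theorem card_det_eq_one [Finite F] :
    Nat.card {s : F × F × F × F // s.1 * s.2.2.2 - s.2.1 * s.2.2.1 = 1} + Nat.card F =
      Nat.card F ^ 3 := by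
  classical
  have hp : ∀ v : {v : F × F // v ∉ ({(0, 0)} : Finset (F × F))},
      ∃ p r, v.1.1 * r - v.1.2 * p = 1 := fun v => exists_det_eq_one (by
    have := v.2
    rw [Finset.mem_singleton, Prod.ext_iff] at this
    tauto)
  choose p r h using hp
  have e : {v : F × F // v ∉ ({(0, 0)} : Finset (F × F))} × F ≃
      {s : F × F × F × F // s.1 * s.2.2.2 - s.2.1 * s.2.2.1 = 1} := by
    refine Equiv.ofBijective (fun s => ⟨(s.1.1.1, s.1.1.2, p s.1 + s.2 * s.1.1.1,
      r s.1 + s.2 * s.1.1.2), (det_eq_one_iff (h s.1) _ _).2 ⟨s.2, rfl, rfl⟩⟩) ⟨?_, ?_⟩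
    · rintro ⟨⟨⟨a, b⟩, hv⟩, t⟩ ⟨⟨⟨a', b'⟩, hv'⟩, t'⟩ hs
      simp only [Subtype.mk.injEq, Prod.mk.injEq] at hs
      obtain ⟨rfl, rfl, h1, h2⟩ := hs
      simp at hv
      have : t = t' := by grind
      rw [this]
    · rintro ⟨⟨a, b, c, d⟩, hs⟩
      have hv : (a, b) ∉ ({(0, 0)} : Finset (F × F)) := by
        rw [Finset.mem_singleton, Prod.mk.injEq]
        rintro ⟨rfl, rfl⟩
        simp at hs
      obtain ⟨t, hc, hd⟩ := (det_eq_one_iff (h ⟨_, hv⟩) _ _).1 hs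
      exact ⟨⟨⟨_, hv⟩, t⟩, Subtype.ext (by simpa [Prod.ext_iff] using ⟨hc.symm, hd.symm⟩)⟩
  rw [← Nat.card_congr e, Nat.card_prod]
  have := Nat.card_subtype_notMem ({(0, 0)} : Finset (F × F))
  rw [Nat.card_prod, Finset.card_singleton] at this
  linear_combination Nat.card F * this

theorem card_valid [Finite F] (hK : D.K.card = 4) :
    Nat.card {v : Vtx F // D.Valid v} + Nat.card F =
      2 * Nat.card F ^ 3 + 2 * Nat.card F ^ 2 + 1 := by
  classical
  have e1 := Nat.card_congr ((Vtx.equivSum F).subtypeEquivOfSubtype' (p := D.Valid))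
  have h1 : Nat.card {s : Option F × F × F // D.Valid (pt s.1 s.2.1 s.2.2)} + 2 =
      (Nat.card F + 1) * Nat.card F ^ 2 := by
    have := Nat.card_subtype_notMem ({(none, 0, 0), (some 0, 0, 0)} : Finset (Option F × F × F))
    rw [Finset.card_pair (by simp)] at this
    simp only [Nat.card_prod, Finite.card_option] at this
    rw [pow_two, ← this]
    congr 1
    refine Nat.card_congr (Equiv.subtypeEquivRight ?_)
    rintro ⟨_ | p, x, y⟩ <;> simp [Valid] <;> grind
  have h2 : Nat.card {i // D.Valid (sp i)} = 4 := by
    rw [← hK, ← Nat.card_eq_finsetCard]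
    rfl
  have h3 : Nat.card {s : F × F × F × F // D.Valid (gl s.1 s.2.1 s.2.2.1 s.2.2.2)} + Nat.card F =
      Nat.card F ^ 3 := card_det_eq_one
  have h4 : Nat.card {s : Option F × Option F // D.Valid (sl s.1 s.2)} + (Nat.card F + 1) * 2 =
      (Nat.card F + 1) * (Nat.card F + 1) := by
    have := Fintype.ofFinite F
    have := Nat.card_subtype_notMem
      ((Finset.univ : Finset (Option F)) ×ˢ ({none, some 0} : Finset (Option F)))
    rw [Finset.card_product, Finset.card_pair (by simp), Finset.card_univ,
      ← Nat.card_eq_fintype_card] at this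
    simp only [Nat.card_prod, Finite.card_option] at this
    rw [← this]
    congr 1
    refine Nat.card_congr (Equiv.subtypeEquivRight ?_)
    rintro ⟨i, r⟩
    simp [Valid]
  rw [e1, Nat.card_congr Equiv.subtypeSum, Nat.card_sum, Nat.card_congr Equiv.subtypeSum,
    Nat.card_sum, Nat.card_congr Equiv.subtypeSum, Nat.card_sum]
  change Nat.card {s : Option F × F × F // D.Valid (pt s.1 s.2.1 s.2.2)} +
    (Nat.card {i // D.Valid (sp i)} +
      (Nat.card {s : F × F × F × F // D.Valid (gl s.1 s.2.1 s.2.2.1 s.2.2.2)} +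
        Nat.card {s : Option F × Option F // D.Valid (sl s.1 s.2)})) + _ = _
  linarith

end MatchingData

theorem FiniteField.isSquare_mul_iff {F : Type*} [Field F] [Finite F] {a b : F}
    (ha : ¬ IsSquare a) (hb : b ≠ 0) : IsSquare (a * b) ↔ ¬ IsSquare b := by
  classical
  have := Fintype.ofFinite F
  have ha0 : a ≠ 0 := by rintro rfl; exact ha (.zero)
  rw [← quadraticChar_neg_one_iff_not_isSquare] at ha ⊢
  rw [← quadraticChar_one_iff_isSquare (mul_ne_zero ha0 hb), map_mul, ha]
  constructor <;> intro h <;> linarith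

theorem FiniteField.exists_nonsquare_ne_neg_one {F : Type*} [Field F] [Finite F]
    (h2 : (2 : F) ≠ 0) (hF : 3 < Nat.card F) : ∃ g : F, ¬ IsSquare g ∧ g ≠ -1 := by
  classical
  have := Fintype.ofFinite F
  obtain ⟨g, hg⟩ := FiniteField.exists_nonsquare (F := F)
    (fun h => h2 (by have := CharP.cast_eq_zero F (ringChar F); rw [h] at this; exact_mod_cast this))
  by_cases h : g = -1
  · obtain ⟨z, hz⟩ : ∃ z, z ∉ ({0, 1, -1} : Finset F) := by
      by_contra! hc
      have := Finset.card_le_card (fun x _ => hc x : (Finset.univ : Finset F) ⊆ {0, 1, -1})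
      rw [Finset.card_univ, ← Nat.card_eq_fintype_card] at this
      have h3 : ({0, 1, -1} : Finset F).card ≤ 3 := Finset.card_le_three
      omega
    simp at hz
    refine ⟨g * (z * z), ?_, ?_⟩
    · rw [isSquare_mul_iff hg (by simp [hz.1])]
      simp
    · intro h'
      rw [h] at h'
      have : (z - 1) * (z + 1) = 0 := by linear_combination -h'
      rcases mul_eq_zero.1 this with h | h
      · exact hz.2.1 (sub_eq_zero.1 h)
      · exact hz.2.2 (eq_neg_of_add_eq_zero_left h)
  · exact ⟨g, hg, h⟩

/-- Scalings by nonsquares that compose to the identity. -/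
theorem exists_scaling {F : Type*} [Field F] [Finite F] (h2 : (2 : F) ≠ 0) (hF : 3 < Nat.card F) :
    ∃ μ : F → F → F, (∀ x y, μ x y ≠ 0) ∧ (∀ x y, μ x y ≠ 1) ∧ (∀ x y, μ x y ≠ -1) ∧
      ∀ x y, x ≠ 0 ∨ y ≠ 0 → μ (μ x y * x) (μ x y * y) * μ x y = 1 := by
  classical
  obtain ⟨g, hg, hg1⟩ := FiniteField.exists_nonsquare_ne_neg_one h2 hF
  let lead (x y : F) : F := if x = 0 then y else x
  let μ (x y : F) : F := if IsSquare (lead x y) then g else g⁻¹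
  have hg0 : g ≠ 0 := by rintro rfl; exact hg (.zero)
  have hμ : ∀ x y, ¬ IsSquare (μ x y) := by
    intro x y
    simp only [μ]
    split_ifs
    · exact hg
    · rwa [isSquare_inv]
  have hμ0 : ∀ x y, μ x y ≠ 0 := fun x y h => hμ x y (h ▸ .zero)
  refine ⟨μ, hμ0, fun x y h => hμ x y (h ▸ .one), fun x y => ?_, fun x y hxy => ?_⟩
  · simp only [μ]
    split_ifs
    · exact hg1
    · rw [Ne, inv_eq_iff_eq_inv]
      simpa using hg1
  · have hl : lead (μ x y * x) (μ x y * y) = μ x y * lead x y := by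
      simp only [lead, mul_eq_zero, hμ0 x y, false_or]
      split_ifs <;> rfl
    have hl0 : lead x y ≠ 0 := by
      simp only [lead]
      split_ifs with h
      · exact hxy.resolve_left (not_not.2 h)
      · exact h
    have h1 := FiniteField.isSquare_mul_iff (hμ x y) hl0
    rw [← hl] at h1
    by_cases h : IsSquare (lead x y)
    · have e1 : μ x y = g := if_pos h
      have e2 : μ (μ x y * x) (μ x y * y) = g⁻¹ := if_neg (fun h' => h1.1 h' h)
      rw [e2, e1, inv_mul_cancel₀ hg0]
    · have e1 : μ x y = g⁻¹ := if_neg h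
      have e2 : μ (μ x y * x) (μ x y * y) = g := if_pos (h1.2 h)
      rw [e2, e1, mul_inv_cancel₀ hg0]

/-- A one-factorization of the complete graph on `α`. -/
theorem exists_oneFactorization {α : Type*} {n : ℕ} (hn : Odd n) (hα : Nat.card α = n + 1) :
    ∃ σ : ZMod n → α → α, (∀ k a, σ k a ≠ a) ∧ (∀ k a, σ k (σ k a) = a) ∧
      ∀ k l a, σ k a = σ l a → k = l := by
  have : NeZero n := ⟨hn.pos.ne'⟩
  obtain ⟨h, hh⟩ : ∃ h : ZMod n, 2 * h = 1 := by
    obtain ⟨m, rfl⟩ := hn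
    refine ⟨m + 1, ?_⟩
    have := ZMod.natCast_self (2 * m + 1)
    push_cast at this
    linear_combination this
  have hfin : Finite α := Nat.finite_of_card_ne_zero (by omega)
  obtain ⟨e⟩ : Nonempty (α ≃ Option (ZMod n)) := by
    rw [← Finite.card_eq]
    simp [hα]
  let s (k : ZMod n) : Option (ZMod n) → Option (ZMod n)
    | none => some (h * k)
    | some x => if x + x = k then none else some (k - x)
  have h1 : ∀ k a, s k a ≠ a := by
    rintro k (_ | x)
    · simp [s]
    · simp only [s]
      split_ifs with hx
      · simp
      · exact fun h' => hx (by simp at h'; linear_combination -h')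
  have h2 : ∀ k a, s k (s k a) = a := by
    rintro k (_ | x)
    · simp only [s]
      rw [if_pos (by linear_combination k * hh)]
    · simp only [s]
      split_ifs with hx
      · simp only [Option.some.injEq]
        linear_combination x * hh - h * hx
      · simp only
        rw [if_neg (fun h' => hx (by linear_combination -h'))]
        simp
  have h3 : ∀ k l a, s k a = s l a → k = l := by
    rintro k l (_ | x) h'
    · simp only [s, Option.some.injEq] at h'
      linear_combination 2 * h' - (k - l) * hh
    · simp only [s] at h'
      split_ifs at h' with hk hl hl
      · exact hk.symm.trans hl
      · simpa using h'
  refine ⟨fun k a => e.symm (s k (e a)), fun k a h' => h1 k (e a) ?_, fun k a => ?_,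
    fun k l a h' => h3 k l (e a) (e.symm.injective h')⟩
  · exact (e.symm_apply_eq.1 h')
  · simp [h2]

theorem exists_matchingData {F : Type*} [Field F] [Finite F] (hodd : Odd (Nat.card F))
    (h2 : (2 : F) ≠ 0) (h5 : 5 ≤ Nat.card F) : ∃ D : MatchingData F, D.K.card = 4 := by
  classical
  have := Fintype.ofFinite F
  obtain ⟨μ, hμ0, hμ1, hμ2, hμ⟩ := exists_scaling h2 (by omega)
  obtain ⟨K, hKs, hK⟩ : ∃ K ⊆ (Finset.univ : Finset (Option F)).erase (some 0), K.card = 4 := by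
    refine Finset.exists_subset_card_eq ?_
    rw [Finset.card_erase_of_mem (Finset.mem_univ _), Finset.card_univ, Fintype.card_option,
      ← Nat.card_eq_fintype_card]
    omega
  obtain ⟨n, hn⟩ : ∃ n, Nat.card F = n + 2 := ⟨Nat.card F - 2, by omega⟩
  have hnodd : Odd n := by
    rw [hn] at hodd
    simpa [Nat.odd_add] using hodd
  have : NeZero n := ⟨hnodd.pos.ne'⟩
  obtain ⟨s, s1, s2, s3⟩ := exists_oneFactorization (α := {c : F // c ≠ 0}) hnodd (by
    have := Nat.card_subtype_notMem ({0} : Finset F)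
    simp only [Finset.mem_singleton, Finset.card_singleton] at this
    change Nat.card {c : F // c ≠ 0} + 1 = _ at this
    omega)
  obtain ⟨ι⟩ : Nonempty ({i // i ∉ K} ↪ ZMod n) := by
    refine Function.Embedding.nonempty_of_card_le ?_
    have := Nat.card_subtype_notMem K
    rw [Finite.card_option, Nat.card_eq_fintype_card] at this
    rw [ZMod.card]
    omega
  let σ (i : Option F) (c : F) : F :=
    if h : i ∉ K ∧ c ≠ 0 then (s (ι ⟨i, h.1⟩) ⟨c, h.2⟩ : F) else 0
  have hσ : ∀ i (hi : i ∉ K) c (hc : c ≠ 0), σ i c = s (ι ⟨i, hi⟩) ⟨c, hc⟩ :=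
    fun i hi c hc => dif_pos ⟨hi, hc⟩
  refine ⟨⟨K, σ, μ, fun h => (Finset.mem_erase.1 (hKs h)).1 rfl, ?_, ?_, ?_, ?_, hμ0, hμ1, hμ2, hμ⟩,
    hK⟩
  · intro i hi c hc
    rw [hσ i hi c hc]
    exact (s _ _).2
  · intro i hi c hc
    rw [hσ i hi c hc]
    exact fun h => s1 _ _ (Subtype.ext h)
  · intro i hi c hc
    rw [hσ i hi c hc, hσ i hi _ (s _ _).2, Subtype.coe_eta, s2]
  · intro i hi j hj c hc h
    rw [hσ i hi c hc, hσ j hj c hc] at h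
    simpa using s3 _ _ _ (Subtype.ext h)

/-- Let q ≥ 5 be an odd prime power. Then there exists a (q+1)-regular graph of
girth 7 with exactly 2q³ + 2q² − q + 1 vertices. -/
theorem stmt_15 (q : ℕ) (hq : IsPrimePow q) (hodd : Odd q) (h5 : 5 ≤ q) :
    ∃ (G : SimpleGraph (Fin (2 * q ^ 3 + 2 * q ^ 2 - q + 1))) (_ : DecidableRel G.Adj),
      G.IsRegularOfDegree (q + 1) ∧ G.girth = 7 := by
  classical
  obtain ⟨p, n, hp, hn, rfl⟩ := hq
  have : Fact p.Prime := ⟨hp.nat_prime⟩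
  have hF : Nat.card (GaloisField p n) = p ^ n := GaloisField.card p n hn.ne'
  have h2 : (2 : GaloisField p n) ≠ 0 := by
    intro h
    have h' : p ∣ 2 := (CharP.cast_eq_zero_iff (GaloisField p n) p 2).1 (by exact_mod_cast h)
    have := (Nat.prime_dvd_prime_iff_eq hp.nat_prime Nat.prime_two).1 h'
    subst this
    exact absurd hodd (by simp [Nat.even_pow, hn.ne'])
  obtain ⟨D, hD⟩ := exists_matchingData (hF ▸ hodd) h2 (hF ▸ h5)
  have hc := D.card_valid hD
  rw [hF] at hc
  have hle : p ^ n ≤ (p ^ n) ^ 2 := Nat.le_self_pow two_ne_zero _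
  have hc' : Nat.card {v // D.Valid v} = 2 * (p ^ n) ^ 3 + 2 * (p ^ n) ^ 2 - p ^ n + 1 := by
    omega
  have := Nat.finite_of_card_ne_zero (hc'.trans_ne (Nat.succ_ne_zero _))
  let e := (Finite.equivFinOfCardEq hc').symm
  let φ : (D.graph h2).comap e ≃g D.graph h2 := SimpleGraph.Iso.comap e _
  refine ⟨(D.graph h2).comap e, inferInstance, fun v => ?_, ?_⟩
  · rw [← SimpleGraph.card_neighborSet_eq_degree, ← Nat.card_eq_fintype_card,
      Nat.card_congr (φ.mapNeighborSet v), D.card_neighborSet h2, Finite.card_option, hF]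
  · rw [φ.girth_eq, D.girth_graph h2]
end
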